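/- arXiv:2510.14918 — 2 statements merged into one kernel-verified Lean document; each statement's English description precedes it below -/
import Mathlib

section
/- There is an absolute constant c > 0 such that for every integer n ≥ 4 and every integer k with 2 ≤ k ≤ c·log log n, every n-vertex edge-weighted tree T admits a shortcutting with hop-diameter k whose treewidth is at most c·k·(log n)^{2/k} when k is even, and at most c·k·(log n / log log n)^{2/(k-1)} when k is odd and k ≥ 3. -/
open SimpleGraph

/-- The weight of a walk: the sum of the weights of its edges. -/
noncomputable def walkWeight {V : Type} {G : SimpleGraph V} (w : Sym2 V → ℝ) {u v : V}
    (p : G.Walk u v) : ℝ := (p.edges.map w).sum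

/-- The unique path between two vertices of a tree (as a walk). -/
noncomputable def treePath {V : Type} {T : SimpleGraph V} (hT : T.IsTree) (u v : V) :
    T.Walk u v :=
  letI := Classical.decEq V
  ((hT.isConnected.preconnected u v).some.toPath : T.Path u v)

/-- The shortest-path metric of an edge-weighted tree. -/
noncomputable def treeDist {V : Type} {T : SimpleGraph V} (hT : T.IsTree) (w : Sym2 V → ℝ)
    (u v : V) : ℝ := walkWeight w (treePath hT u v)

/-- `H` is a 1-spanner with hop-diameter `k` of the distance function `d`:
between every two vertices there is a path in `H` with at most `k` edges whose
total weight equals their distance. -/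
def IsOneSpannerHop {V : Type} (H : SimpleGraph V) (d : V → V → ℝ) (k : ℕ) : Prop :=
  ∀ u v : V, ∃ (m : ℕ) (x : Fin (m+1) → V), m ≤ k ∧ x 0 = u ∧ x (Fin.last m) = v ∧
    (∀ i : Fin m, H.Adj (x i.castSucc) (x i.succ)) ∧
    (∑ i : Fin m, d (x i.castSucc) (x i.succ)) = d u v

/-- `H` is a `t`-spanner with hop-diameter `k` of the distance function `d`. -/
def IsSpannerHop {V : Type} (H : SimpleGraph V) (d : V → V → ℝ) (k : ℕ) (t : ℝ) : Prop :=
  ∀ u v : V, ∃ (m : ℕ) (x : Fin (m+1) → V), m ≤ k ∧ x 0 = u ∧ x (Fin.last m) = v ∧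
    (∀ i : Fin m, H.Adj (x i.castSucc) (x i.succ)) ∧
    (∑ i : Fin m, d (x i.castSucc) (x i.succ)) ≤ t * d u v

/-- A tree decomposition of a graph `G` with index type `ι`. -/
structure TreeDecomp {V : Type} (G : SimpleGraph V) (ι : Type) where
  tree : SimpleGraph ι
  tree_isTree : tree.IsTree
  bag : ι → Finset V
  mem_bag : ∀ v : V, ∃ i, v ∈ bag i
  edge_bag : ∀ u v : V, G.Adj u v → ∃ i, u ∈ bag i ∧ v ∈ bag i
  bag_connected : ∀ v : V, (tree.induce {i : ι | v ∈ bag i}).Connected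

/-- The treewidth of `G` is at most the real number `r`. -/
def TreewidthLE {V : Type} (G : SimpleGraph V) (r : ℝ) : Prop :=
  ∃ (ι : Type) (td : TreeDecomp G ι), ∀ i : ι, ((td.bag i).card : ℝ) - 1 ≤ r

/-- The treewidth of `G` is at least the real number `r`. -/
def TreewidthGE {V : Type} (G : SimpleGraph V) (r : ℝ) : Prop :=
  ∀ (ι : Type) (td : TreeDecomp G ι), ∃ i : ι, r ≤ ((td.bag i).card : ℝ) - 1

/-- The arboricity of `G` is at most `m`: the edges of `G` can be covered by `m` forests. -/
def ArboricityLE {V : Type} (G : SimpleGraph V) (m : ℕ) : Prop :=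
  ∃ F : Fin m → SimpleGraph V, (∀ i, F i ≤ G) ∧ (∀ i, (F i).IsAcyclic) ∧
    ∀ u v : V, G.Adj u v → ∃ i, (F i).Adj u v

/-- The arboricity of `G` is at most the real number `r`. -/
def ArboricityLEReal {V : Type} (G : SimpleGraph V) (r : ℝ) : Prop :=
  ∃ m : ℕ, (m : ℝ) ≤ r ∧ ArboricityLE G m

/-- Ackermann-type function `A`. -/
def ackA : ℕ → ℕ → ℕ
  | 0, n => 2 * n
  | _ + 1, 0 => 1
  | k + 1, n + 1 => ackA k (ackA (k + 1) n)

/-- Ackermann-type function `B`. -/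
def ackB : ℕ → ℕ → ℕ
  | 0, n => n ^ 2
  | _ + 1, 0 => 2
  | k + 1, n + 1 => ackB k (ackB (k + 1) n)

/-- The inverse Ackermann function `α_j(n)`:
`α_{2k}(n) = min {s : A(k,s) ≥ n}` and `α_{2k+1}(n) = min {s : B(k,s) ≥ n}`. -/
noncomputable def invAck (j n : ℕ) : ℕ :=
  if j % 2 = 0 then sInf {s : ℕ | n ≤ ackA (j / 2) s} else sInf {s : ℕ | n ≤ ackB (j / 2) s}

/-- The uniform line metric on `{0, …, n-1}`. -/
def lineDist (n : ℕ) (i j : Fin n) : ℝ := |(i : ℝ) - (j : ℝ)|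

/-- `x` is an ancestor of `y` in the tree `T` rooted at `r`:
`x` lies on the unique path from `r` to `y`. -/
def IsAncestor {V : Type} {T : SimpleGraph V} (hT : T.IsTree) (r x y : V) : Prop :=
  x ∈ (treePath hT r y).support

/-- `G` contains `K_t` as a minor: there are `t` pairwise disjoint connected vertex
subsets with an edge between every two of them. -/
def HasCliqueMinor {V : Type} (G : SimpleGraph V) (t : ℕ) : Prop :=
  ∃ B : Fin t → Set V,
    (∀ i j, i ≠ j → Disjoint (B i) (B j)) ∧
    (∀ i, (G.induce (B i)).Connected) ∧
    (∀ i j, i ≠ j → ∃ u ∈ B i, ∃ v ∈ B j, G.Adj u v)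

/-- A rooted tree, built from single vertices by hanging the root of one rooted tree
below the root of another. -/
inductive JoinTree (V : Type) : Type
  | single (v : V) : JoinTree V
  | join (a b : JoinTree V) : JoinTree V

namespace JoinTree

variable {V : Type} [DecidableEq V]

def root : JoinTree V → V
  | single v => v
  | join a _ => a.root

def size : JoinTree V → ℕ
  | single _ => 1
  | join a b => a.size + b.size

def verts : JoinTree V → Finset V
  | single v => {v}
  | join a b => a.verts ∪ b.verts

def edges : JoinTree V → Finset (Sym2 V)
  | single _ => ∅
  | join a b => insert s(a.root, b.root) (a.edges ∪ b.edges)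

def Valid : JoinTree V → Prop
  | single _ => True
  | join a b => a.Valid ∧ b.Valid ∧ Disjoint a.verts b.verts

/-- Attach a new leaf `v` to the vertex `u`. -/
def attach (u v : V) : JoinTree V → JoinTree V
  | single x => if x = u then join (single x) (single v) else single x
  | join a b => join (a.attach u v) (b.attach u v)

theorem root_mem_verts : ∀ t : JoinTree V, t.root ∈ t.verts
  | single v => by simp [root, verts]
  | join a b => by simp [root, verts, root_mem_verts a]

theorem mem_verts_of_mem_edges : ∀ (t : JoinTree V), ∀ e ∈ t.edges, ∀ x ∈ e, x ∈ t.verts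
  | single v => by simp [edges]
  | join a b => by
    intro e he x hx
    simp only [edges, Finset.mem_insert, Finset.mem_union] at he
    simp only [verts, Finset.mem_union]
    rcases he with rfl | he | he
    · rcases Sym2.mem_iff.1 hx with rfl | rfl
      · exact Or.inl a.root_mem_verts
      · exact Or.inr b.root_mem_verts
    · exact Or.inl (mem_verts_of_mem_edges a e he x hx)
    · exact Or.inr (mem_verts_of_mem_edges b e he x hx)

theorem Valid.card_verts : ∀ {t : JoinTree V}, t.Valid → t.verts.card = t.size
  | single v, _ => by simp [verts, size]
  | join a b, h => by
    obtain ⟨ha, hb, hd⟩ := h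
    simp [verts, size, Finset.card_union_of_disjoint hd, ha.card_verts, hb.card_verts]

theorem Valid.card_edges : ∀ {t : JoinTree V}, t.Valid → t.edges.card + 1 = t.size
  | single v, _ => by simp [edges, size]
  | join a b, h => by
    obtain ⟨ha, hb, hd⟩ := h
    have hd' := Finset.disjoint_left.1 hd
    have h1 : s(a.root, b.root) ∉ a.edges ∪ b.edges := by
      intro h
      rcases Finset.mem_union.1 h with h | h
      · exact hd' (a.mem_verts_of_mem_edges _ h b.root (by simp)) b.root_mem_verts
      · exact hd' a.root_mem_verts (b.mem_verts_of_mem_edges _ h a.root (by simp))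
    have h2 : Disjoint a.edges b.edges := by
      rw [Finset.disjoint_left]
      intro e hea heb
      induction e with | h x y =>
      exact hd' (a.mem_verts_of_mem_edges _ hea x (by simp))
        (b.mem_verts_of_mem_edges _ heb x (by simp))
    have ha' := ha.card_edges
    have hb' := hb.card_edges
    simp only [edges, size, Finset.card_insert_of_notMem h1, Finset.card_union_of_disjoint h2]
    omega

theorem root_attach (u v : V) : ∀ t : JoinTree V, (t.attach u v).root = t.root
  | single x => by
    unfold attach
    split <;> simp [root]
  | join a b => by simp [attach, root, root_attach u v a]

theorem verts_attach (u v : V) : ∀ t : JoinTree V,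
    (t.attach u v).verts = if u ∈ t.verts then insert v t.verts else t.verts
  | single x => by
    unfold attach
    by_cases h : x = u
    · subst h
      ext y
      simp [verts, or_comm]
    · simp [verts, h, Ne.symm h]
  | join a b => by
    ext y
    simp only [attach, verts, verts_attach u v a, verts_attach u v b, Finset.mem_union]
    split_ifs <;> simp_all <;> tauto

theorem edges_attach_subset (u v : V) : ∀ t : JoinTree V,
    (t.attach u v).edges ⊆ insert s(u, v) t.edges
  | single x => by
    unfold attach
    by_cases h : x = u
    · subst h
      simp [edges, root]
    · simp [edges, h]
  | join a b => by
    have ha := edges_attach_subset u v a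
    have hb := edges_attach_subset u v b
    intro e he
    simp only [attach, edges, root_attach, Finset.mem_insert, Finset.mem_union] at he ⊢
    rcases he with he | he | he
    · exact Or.inr (Or.inl he)
    · have := ha he
      simp only [Finset.mem_insert] at this
      tauto
    · have := hb he
      simp only [Finset.mem_insert] at this
      tauto

theorem Valid.attach {u v : V} : ∀ {t : JoinTree V}, t.Valid → v ∉ t.verts →
    (t.attach u v).Valid
  | single x, _, hv => by
    unfold JoinTree.attach
    split
    · simp_all [Valid, verts, eq_comm]
    · trivial
  | join a b, h, hv => by
    obtain ⟨ha, hb, hd⟩ := h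
    simp only [verts, Finset.mem_union, not_or] at hv
    refine ⟨ha.attach hv.1, hb.attach hv.2, ?_⟩
    rw [verts_attach, verts_attach]
    have hd' := Finset.disjoint_left.1 hd
    split_ifs with h1 h2 h2
    · exact absurd h2 (hd' h1)
    · exact Finset.disjoint_insert_left.2 ⟨hv.2, hd⟩
    · exact Finset.disjoint_insert_right.2 ⟨hv.1, hd⟩
    · exact hd

end JoinTree

/-- Every finite tree is described by a `JoinTree`. -/
theorem exists_joinTree {V : Type} [Fintype V] [DecidableEq V] {T : SimpleGraph V}
    (hT : T.IsTree) :
    ∃ t : JoinTree V, t.Valid ∧ t.verts = Finset.univ ∧ ∀ u v, T.Adj u v → s(u, v) ∈ t.edges := by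
  classical
  have key : ∀ m : ℕ, m + 1 ≤ Fintype.card V →
      ∃ t : JoinTree V, t.Valid ∧ t.size = m + 1 ∧ ∀ e ∈ t.edges, e ∈ T.edgeSet := by
    intro m
    induction m with
    | zero =>
      intro _
      obtain ⟨v⟩ := hT.connected.nonempty
      exact ⟨.single v, trivial, rfl, by simp [JoinTree.edges]⟩
    | succ m ih =>
      intro hm
      obtain ⟨t, ht, hs, he⟩ := ih (by omega)
      have hne : t.verts ≠ Finset.univ := by
        intro h
        have := ht.card_verts
        rw [h, Finset.card_univ] at this
        omega
      obtain ⟨y, hy⟩ : ∃ y, y ∉ t.verts := by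
        by_contra! h
        exact hne (Finset.eq_univ_of_forall h)
      obtain ⟨p⟩ := hT.connected.preconnected t.root y
      obtain ⟨⟨⟨u, v⟩, huv⟩, -, hu, hv⟩ :=
        p.exists_boundary_dart (t.verts : Set V) t.root_mem_verts hy
      simp only [Finset.mem_coe] at hu hv
      have hval := ht.attach (u := u) hv
      refine ⟨t.attach u v, hval, ?_, ?_⟩
      · rw [← hval.card_verts, JoinTree.verts_attach, if_pos hu, Finset.card_insert_of_notMem hv,
          ht.card_verts, hs]
      · intro e h
        rcases Finset.mem_insert.1 (t.edges_attach_subset u v h) with rfl | h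
        · exact huv
        · exact he e h
  have hpos : 0 < Fintype.card V := by
    obtain ⟨v⟩ := hT.connected.nonempty
    exact Fintype.card_pos_iff.2 ⟨v⟩
  obtain ⟨t, ht, hs, he⟩ := key (Fintype.card V - 1) (by omega)
  refine ⟨t, ht, ?_, ?_⟩
  · apply Finset.eq_univ_of_card
    rw [ht.card_verts]
    omega
  · have hsub : t.edges ⊆ T.edgeFinset := fun e h => by simpa using he e h
    have hcard := hT.card_edgeFinset
    have hc := ht.card_edges
    have heq : t.edges = T.edgeFinset := Finset.eq_of_subset_of_card_le hsub (by omega)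
    intro u v huv
    rw [heq]
    simpa using huv

/-- `Cluster S E B d`: the graph with vertices `S` and edges `E` is obtained from graphs on at most
two vertices by a binary gluing scheme of depth `d`, in which each part is glued to the rest
along a boundary of at most two vertices; `B` is the boundary of the graph itself. -/
inductive Cluster {V : Type} [DecidableEq V] :
    Finset V → Finset (Sym2 V) → Finset V → ℕ → Prop
  | base (S : Finset V) (E : Finset (Sym2 V)) (d : ℕ) (hS : S.card ≤ 2)
      (hE : ∀ e ∈ E, ∀ x ∈ e, x ∈ S) : Cluster S E S d
  | glue {S₁ S₂ S : Finset V} {E₁ E₂ E : Finset (Sym2 V)} {B₁ B₂ B : Finset V} {d : ℕ}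
      (h₁ : Cluster S₁ E₁ B₁ d) (h₂ : Cluster S₂ E₂ B₂ d) (hS : S = S₁ ∪ S₂) (hE : E ⊆ E₁ ∪ E₂)
      (hi : S₁ ∩ S₂ ⊆ B₁ ∩ B₂) (hB : B ⊆ B₁ ∪ B₂) (hc : B.card ≤ 2) : Cluster S E B (d + 1)

namespace Cluster

variable {V : Type} [DecidableEq V]

theorem mono {S : Finset V} {E : Finset (Sym2 V)} {B : Finset V} {d d' : ℕ}
    (h : Cluster S E B d) (hd : d ≤ d') : Cluster S E B d' := by
  induction h generalizing d' with
  | base S E d hS hE => exact base S E d' hS hE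
  | glue h₁ h₂ hS hE hi hB hc ih₁ ih₂ =>
    obtain ⟨d', rfl⟩ : ∃ m, d' = m + 1 := ⟨d' - 1, by omega⟩
    exact glue (ih₁ (by omega)) (ih₂ (by omega)) hS hE hi hB hc

end Cluster

/-- A rooted tree with a hole: a sequence of trees, each of which is joined with what follows it.
The flag tells whether the root of what follows remains the root. -/
abbrev TreeContext (V : Type) : Type := List (Bool × JoinTree V)

namespace TreeContext

variable {V : Type}

def size : TreeContext V → ℕ
  | [] => 0
  | x :: C => x.2.size + size C

/-- The root of a context whose hole is filled with a tree of root `r`. -/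
def root (r : V) : TreeContext V → V
  | [] => r
  | x :: C => if x.1 then root r C else x.2.root

theorem root_append (r : V) (C' : TreeContext V) :
    ∀ C : TreeContext V, root r (C ++ C') = root (root r C') C
  | [] => rfl
  | x :: C => by
    have := root_append r C' C
    simp [root, this]

theorem size_append (C' : TreeContext V) :
    ∀ C : TreeContext V, size (C ++ C') = size C + size C'
  | [] => by simp [size]
  | x :: C => by
    have := size_append C' C
    simp [size, this, add_assoc]

/-- Split a context at the first position where the accumulated size exceeds `N`. -/
theorem exists_split : ∀ (C : TreeContext V) (N : ℕ), N < size C →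
    ∃ C₁ x C₂, C = C₁ ++ x :: C₂ ∧ size C₁ ≤ N ∧ N < size C₁ + x.2.size
  | [], N, h => by simp [size] at h
  | y :: C, N, h => by
    by_cases hy : N < y.2.size
    · exact ⟨[], y, C, rfl, by simp [size], by simpa [size] using hy⟩
    · simp only [size] at h
      obtain ⟨C₁, x, C₂, rfl, h1, h2⟩ := exists_split C (N - y.2.size) (by omega)
      exact ⟨y :: C₁, x, C₂, rfl, by simp only [size]; omega, by simp only [size]; omega⟩

variable [DecidableEq V]

def verts (r : V) : TreeContext V → Finset V
  | [] => {r}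
  | x :: C => x.2.verts ∪ verts r C

def edges (r : V) : TreeContext V → Finset (Sym2 V)
  | [] => ∅
  | x :: C => insert s(x.2.root, root r C) (x.2.edges ∪ edges r C)

def Valid (r : V) : TreeContext V → Prop
  | [] => True
  | x :: C => x.2.Valid ∧ Valid r C ∧ Disjoint x.2.verts (verts r C)

theorem hole_mem_verts (r : V) : ∀ C : TreeContext V, r ∈ verts r C
  | [] => by simp [verts]
  | x :: C => by simp [verts, hole_mem_verts r C]

theorem root_mem_verts (r : V) : ∀ C : TreeContext V, root r C ∈ verts r C
  | [] => by simp [verts, root]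
  | x :: C => by
    have := root_mem_verts r C
    have h2 := x.2.root_mem_verts
    unfold root verts
    split <;> simp [*]

theorem verts_append (r : V) (C' : TreeContext V) :
    ∀ C : TreeContext V, verts r (C ++ C') = verts (root r C') C ∪ verts r C'
  | [] => by
    have := root_mem_verts r C'
    simp [verts, this]
  | x :: C => by
    have := verts_append r C' C
    simp [verts, this]

theorem edges_append (r : V) (C' : TreeContext V) :
    ∀ C : TreeContext V, edges r (C ++ C') = edges (root r C') C ∪ edges r C'
  | [] => by simp [edges]
  | x :: C => by
    have := edges_append r C' C
    simp [edges, this, root_append]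

theorem Valid.append {r : V} {C' : TreeContext V} :
    ∀ {C : TreeContext V}, Valid r (C ++ C') → Valid (root r C') C ∧ Valid r C' ∧
      verts (root r C') C ∩ verts r C' ⊆ {root r C'}
  | [], h => ⟨trivial, h, Finset.inter_subset_left⟩
  | x :: C, h => by
    obtain ⟨h1, h2, h3⟩ := h
    obtain ⟨h4, h5, h6⟩ := Valid.append (C := C) h2
    change Disjoint x.2.verts (verts r (C ++ C')) at h3
    rw [verts_append, Finset.disjoint_union_right] at h3
    refine ⟨⟨h1, h4, h3.1⟩, h5, ?_⟩
    rw [verts, Finset.union_inter_distrib_right, Finset.disjoint_iff_inter_eq_empty.1 h3.2]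
    simpa using h6

/-- A balanced gluing scheme of depth `d` for a context with hole `r`. -/
def IsCluster (r : V) (C : TreeContext V) (d : ℕ) : Prop :=
  Cluster (verts r C) (edges r C) {root r C, r} d

theorem isCluster_nil (r : V) (d : ℕ) : IsCluster r [] d := by
  have := Cluster.base ({r} : Finset V) ∅ d (by simp) (by simp)
  simpa [IsCluster, verts, edges, root] using this

theorem isCluster_singleton {r : V} {x : Bool × JoinTree V} {d : ℕ} (hx : Valid r [x])
    (h : Cluster x.2.verts x.2.edges {x.2.root} d) : IsCluster r [x] (d + 1) := by
  have hr : r ∉ x.2.verts := by simpa [verts] using hx.2.2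
  have hb := Cluster.base ({x.2.root, r} : Finset V) {s(x.2.root, r)} d Finset.card_le_two
    (by simp)
  have hroot := x.2.root_mem_verts
  refine Cluster.glue h hb ?_ ?_ ?_ ?_ Finset.card_le_two
  · ext y
    simp only [verts, Finset.mem_union, Finset.mem_insert, Finset.mem_singleton]
    constructor
    · tauto
    · rintro (h | rfl | rfl) <;> tauto
  · intro e
    simp only [edges, root, Finset.mem_union, Finset.mem_insert, Finset.mem_singleton,
      Finset.notMem_empty]
    tauto
  · intro y
    simp only [Finset.mem_inter, Finset.mem_insert, Finset.mem_singleton]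
    rintro ⟨h1, rfl | rfl⟩ <;> tauto
  · intro y
    simp only [root, Finset.mem_union, Finset.mem_insert, Finset.mem_singleton]
    split <;> tauto

theorem IsCluster.append {r : V} {C C' : TreeContext V} {d : ℕ} (hv : Valid r (C ++ C'))
    (h : IsCluster (root r C') C d) (h' : IsCluster r C' d) : IsCluster r (C ++ C') (d + 1) := by
  refine Cluster.glue h h' (verts_append r C' C) (edges_append r C' C).le ?_ ?_ Finset.card_le_two
  · refine hv.append.2.2.trans ?_
    simp
  · rw [root_append]
    intro y
    simp only [Finset.mem_union, Finset.mem_insert, Finset.mem_singleton]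
    tauto

/-- Cut a tree at its lowest heavy vertex reached by following heavy subtrees. -/
theorem exists_heavy_split {N : ℕ} (hN : 1 ≤ N) : ∀ t : JoinTree V, t.Valid → N < t.size →
    ∃ (C : TreeContext V) (a b : JoinTree V), (a.join b).Valid ∧ Valid a.root C ∧
      verts a.root C ∩ (a.join b).verts ⊆ {a.root} ∧
      t.verts = verts a.root C ∪ (a.join b).verts ∧
      t.edges = edges a.root C ∪ (a.join b).edges ∧ t.root = root a.root C ∧
      t.size = size C + (a.join b).size ∧ a.size ≤ N ∧ b.size ≤ N ∧ N < (a.join b).size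
  | .single v, _, h => by
    simp only [JoinTree.size] at h
    omega
  | .join p q, ht, h => by
    obtain ⟨hp, hq, hd⟩ := ht
    by_cases h1 : N < p.size
    · obtain ⟨C, a, b, hab, hC, hi, hv, he, hr, hs, ha, hb, hN'⟩ :=
        exists_heavy_split hN p hp h1
      rw [hv, Finset.disjoint_union_left] at hd
      refine ⟨(true, q) :: C, a, b, hab, ⟨hq, hC, hd.1.symm⟩, ?_, ?_, ?_, ?_, ?_, ha, hb, hN'⟩
      · rw [verts, Finset.union_inter_distrib_right,
          Finset.disjoint_iff_inter_eq_empty.1 hd.2.symm]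
        simpa using hi
      · ext y
        simp only [JoinTree.verts, verts, hv, Finset.mem_union]
        tauto
      · ext y
        rw [JoinTree.edges, edges, he, hr, Sym2.eq_swap]
        simp only [Finset.mem_union, Finset.mem_insert]
        tauto
      · simp [JoinTree.root, root, hr]
      · simp only [JoinTree.size, size] at hs ⊢
        omega
    · by_cases h2 : N < q.size
      · obtain ⟨C, a, b, hab, hC, hi, hv, he, hr, hs, ha, hb, hN'⟩ :=
          exists_heavy_split hN q hq h2
        rw [hv, Finset.disjoint_union_right] at hd
        refine ⟨(false, p) :: C, a, b, hab, ⟨hp, hC, hd.1⟩, ?_, ?_, ?_, ?_, ?_, ha, hb, hN'⟩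
        · rw [verts, Finset.union_inter_distrib_right,
            Finset.disjoint_iff_inter_eq_empty.1 hd.2]
          simpa using hi
        · ext y
          simp only [JoinTree.verts, verts, hv, Finset.mem_union]
          tauto
        · ext y
          rw [JoinTree.edges, edges, he, hr]
          simp only [Finset.mem_union, Finset.mem_insert]
          tauto
        · simp [JoinTree.root, root]
        · simp only [JoinTree.size, size] at hs ⊢
          omega
      · refine ⟨[], p, q, ⟨hp, hq, hd⟩, trivial, ?_, ?_, ?_, rfl, ?_, by omega, by omega, h⟩
        · exact Finset.inter_subset_left
        · have := p.root_mem_verts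
          simp [verts, JoinTree.verts, this]
        · simp [edges]
        · simp [size]

end TreeContext

namespace JoinTree

variable {V : Type} [DecidableEq V]

theorem cluster_join {a b : JoinTree V} {d : ℕ} (h : (a.join b).Valid)
    (ha : Cluster a.verts a.edges {a.root} d) (hb : Cluster b.verts b.edges {b.root} d) :
    Cluster (a.join b).verts (a.join b).edges {a.root} (d + 2) := by
  have hd := Finset.disjoint_left.1 h.2.2
  have har := a.root_mem_verts
  have hbr := b.root_mem_verts
  have h1 := Cluster.base ({a.root, b.root} : Finset V) {s(a.root, b.root)} d Finset.card_le_two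
    (by simp)
  have h2 : Cluster (a.verts ∪ {a.root, b.root}) (a.edges ∪ {s(a.root, b.root)})
      {a.root, b.root} (d + 1) := by
    refine Cluster.glue ha h1 rfl le_rfl ?_ ?_ Finset.card_le_two
    · intro y
      simp only [Finset.mem_inter, Finset.mem_insert, Finset.mem_singleton]
      rintro ⟨h1, rfl | rfl⟩ <;> tauto
    · exact Finset.subset_union_right
  refine Cluster.glue h2 (hb.mono (Nat.le_succ d)) ?_ ?_ ?_ ?_ (by simp)
  · ext y
    simp only [verts, Finset.mem_union, Finset.mem_insert, Finset.mem_singleton]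
    constructor
    · tauto
    · rintro ((h | rfl | rfl) | h) <;> tauto
  · intro e
    simp only [edges, Finset.mem_union, Finset.mem_insert, Finset.mem_singleton]
    tauto
  · intro y
    simp only [Finset.mem_inter, Finset.mem_union, Finset.mem_insert, Finset.mem_singleton]
    rintro ⟨h1 | rfl | rfl, h2⟩
    · exact absurd h2 (hd h1)
    · exact absurd h2 (hd har)
    · tauto
  · simp

/-- Trees with at most `2 ^ e` vertices, and contexts of that size, have gluing schemes of depth
linear in `e`. -/
theorem exists_cluster (e : ℕ) :
    (∀ t : JoinTree V, t.Valid → t.size ≤ 2 ^ e →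
      Cluster t.verts t.edges {t.root} (4 * e)) ∧
    (∀ (r : V) (C : TreeContext V), TreeContext.Valid r C → TreeContext.size C ≤ 2 ^ e →
      TreeContext.IsCluster r C (4 * e + 3)) := by
  have size_pos : ∀ t : JoinTree V, 0 < t.size := by
    intro t
    induction t with
    | single v => simp [size]
    | join a b iha ihb => simp only [size]; omega
  have ctx : ∀ (e N : ℕ), (∀ t : JoinTree V, t.Valid → t.size ≤ 2 ^ e →
        Cluster t.verts t.edges {t.root} (4 * e)) →
      (∀ (r : V) (C : TreeContext V), TreeContext.Valid r C → TreeContext.size C ≤ N →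
        TreeContext.IsCluster r C (4 * e + 1)) → 2 ^ e ≤ 2 * N + 1 →
      ∀ (r : V) (C : TreeContext V), TreeContext.Valid r C → TreeContext.size C ≤ 2 ^ e →
      TreeContext.IsCluster r C (4 * e + 3) := by
    intro e N hA hB hN r C hC hs
    by_cases hs' : TreeContext.size C ≤ N
    · exact (hB r C hC hs').mono (by omega)
    obtain ⟨C₁, x, C₂, rfl, h1, h2⟩ := TreeContext.exists_split C N (by omega)
    rw [TreeContext.size_append] at hs
    simp only [TreeContext.size] at hs
    obtain ⟨v1, v2, -⟩ := hC.append
    have v2' : TreeContext.Valid r ([x] ++ C₂) := v2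
    obtain ⟨v3, v4, -⟩ := v2'.append
    have c1 := hB _ C₁ v1 h1
    have c2 := hB r C₂ v4 (by omega)
    have cx := TreeContext.isCluster_singleton v3 (hA x.2 v2.1 (by omega))
    exact TreeContext.IsCluster.append hC (c1.mono (Nat.le_succ _))
      (TreeContext.IsCluster.append v2' cx c2)
  induction e with
  | zero =>
    have hA : ∀ t : JoinTree V, t.Valid → t.size ≤ 2 ^ 0 →
        Cluster t.verts t.edges {t.root} (4 * 0) := by
      intro t _ hs
      cases t with
      | single v => exact Cluster.base {v} ∅ _ (by simp) (by simp)
      | join a b =>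
        have := size_pos a
        have := size_pos b
        simp only [size] at hs
        omega
    refine ⟨hA, ctx 0 0 hA ?_ (by simp)⟩
    intro r C _ hs
    cases C with
    | nil => exact TreeContext.isCluster_nil r _
    | cons x C =>
      have := size_pos x.2
      simp only [TreeContext.size] at hs
      omega
  | succ e ih =>
    obtain ⟨hA, hB⟩ := ih
    have hA' : ∀ t : JoinTree V, t.Valid → t.size ≤ 2 ^ (e + 1) →
        Cluster t.verts t.edges {t.root} (4 * (e + 1)) := by
      intro t ht hs
      by_cases hs' : t.size ≤ 2 ^ e
      · exact (hA t ht hs').mono (by omega)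
      obtain ⟨C, a, b, hab, hC, hi, hv, he, hr, hs2, ha, hb, hN⟩ :=
        TreeContext.exists_heavy_split (N := 2 ^ e) Nat.one_le_two_pow t ht (by omega)
      have hc := hB _ C hC (by rw [pow_succ] at hs; omega)
      have hj := cluster_join hab (hA a hab.1 ha) (hA b hab.2.1 hb)
      refine Cluster.glue hc (hj.mono (Nat.le_succ (4 * e + 2))) hv he.le ?_ ?_ (by simp)
      · refine hi.trans ?_
        simp
      · rw [hr]
        simp
    refine ⟨hA', ctx (e + 1) (2 ^ e) hA' ?_ (by rw [pow_succ]; omega)⟩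
    intro r C hC hs
    exact (hB r C hC hs).mono (by omega)

end JoinTree

/-- A labelling `W` of the infinite binary tree (with nodes addressed by strings, the root being
`[]`) which is a tree decomposition, of depth `D` and with bags of size at most four, of the graph
with vertices `S` and edges `E`, such that `B` is contained in the root bag. -/
structure IsLabelling {V : Type} [DecidableEq V] (S : Finset V) (E : Finset (Sym2 V))
    (B : Finset V) (D : ℕ) (W : List Bool → Finset V) : Prop where
  card_le : ∀ l, (W l).card ≤ 4
  length_le : ∀ l, (W l).Nonempty → l.length ≤ D
  subset : ∀ l, W l ⊆ S
  exists_mem : ∀ v ∈ S, ∃ l, v ∈ W l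
  exists_edge : ∀ e ∈ E, ∃ l, ∀ x ∈ e, x ∈ W l
  root : B ⊆ W []
  exists_top : ∀ v, ∃ a, ∀ l, v ∈ W l → a <+: l ∧ ∀ r, a <+: r → r <+: l → v ∈ W r

theorem Cluster.exists_isLabelling {V : Type} [DecidableEq V] {S : Finset V}
    {E : Finset (Sym2 V)} {B : Finset V} {d : ℕ} (h : Cluster S E B d) :
    B.card ≤ 2 ∧ ∃ W, IsLabelling S E B d W := by
  induction h with
  | base S E d hS hE =>
    refine ⟨hS, fun l => if l = [] then S else ∅, ?_, ?_, ?_, ?_, ?_, ?_, ?_⟩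
    · intro l
      split
      · omega
      · simp
    · intro l hl
      by_cases h : l = [] <;> simp_all
    · intro l
      split <;> simp
    · exact fun v hv => ⟨[], by simpa using hv⟩
    · exact fun e he => ⟨[], by simpa using hE e he⟩
    · simp
    · refine fun v => ⟨[], fun l hl => ⟨List.nil_prefix, fun r _ hr => ?_⟩⟩
      have hl' : l = [] := by
        by_contra h
        simp [h] at hl
      subst hl'
      rw [List.prefix_nil.1 hr]
      exact hl
  | @glue S₁ S₂ S E₁ E₂ E B₁ B₂ B d h₁ h₂ hS hE hi hB hc ih₁ ih₂ =>
    obtain ⟨c₁, W₁, w₁⟩ := ih₁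
    obtain ⟨c₂, W₂, w₂⟩ := ih₂
    subst hS
    have hB₁ : B₁ ⊆ S₁ := w₁.root.trans (w₁.subset _)
    have hB₂ : B₂ ⊆ S₂ := w₂.root.trans (w₂.subset _)
    let W : List Bool → Finset V := fun l => match l with
      | [] => B₁ ∪ B₂
      | false :: l => W₁ l
      | true :: l => W₂ l
    refine ⟨hc, W, ?_, ?_, ?_, ?_, ?_, hB, ?_⟩
    · rintro (_ | ⟨_ | _, l⟩)
      · exact (Finset.card_union_le _ _).trans (by omega)
      · exact w₁.card_le l
      · exact w₂.card_le l
    · rintro (_ | ⟨_ | _, l⟩) hl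
      · simp
      · have := w₁.length_le l hl
        simpa using this
      · have := w₂.length_le l hl
        simpa using this
    · rintro (_ | ⟨_ | _, l⟩)
      · exact Finset.union_subset_union hB₁ hB₂
      · exact (w₁.subset l).trans Finset.subset_union_left
      · exact (w₂.subset l).trans Finset.subset_union_right
    · intro v hv
      rcases Finset.mem_union.1 hv with hv | hv
      · obtain ⟨l, hl⟩ := w₁.exists_mem v hv
        exact ⟨false :: l, hl⟩
      · obtain ⟨l, hl⟩ := w₂.exists_mem v hv
        exact ⟨true :: l, hl⟩
    · intro e he
      rcases Finset.mem_union.1 (hE he) with he | he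
      · obtain ⟨l, hl⟩ := w₁.exists_edge e he
        exact ⟨false :: l, hl⟩
      · obtain ⟨l, hl⟩ := w₂.exists_edge e he
        exact ⟨true :: l, hl⟩
    · intro v
      obtain ⟨a₁, ha₁⟩ := w₁.exists_top v
      obtain ⟨a₂, ha₂⟩ := w₂.exists_top v
      have hmem : v ∈ S₁ → v ∈ S₂ → v ∈ B₁ ∧ v ∈ B₂ := fun h₁ h₂ =>
        Finset.mem_inter.1 (hi (Finset.mem_inter.2 ⟨h₁, h₂⟩))
      by_cases hv : v ∈ B₁ ∪ B₂
      · refine ⟨[], fun l hl => ⟨List.nil_prefix, fun r _ hr => ?_⟩⟩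
        rcases r with _ | ⟨b, r⟩
        · exact hv
        obtain ⟨l, rfl⟩ : ∃ l', l = b :: l' := by
          obtain ⟨s, rfl⟩ := hr
          exact ⟨r ++ s, rfl⟩
        have hr' : r <+: l := by simpa using hr
        rcases b with _ | _
        · have hv₁ : v ∈ B₁ := by
            rcases Finset.mem_union.1 hv with h | h
            · exact h
            · exact (hmem (w₁.subset _ hl) (hB₂ h)).1
          have h0 := (ha₁ [] (w₁.root hv₁)).1
          exact (ha₁ l hl).2 r (h0.trans List.nil_prefix) hr'
        · have hv₂ : v ∈ B₂ := by
            rcases Finset.mem_union.1 hv with h | h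
            · exact (hmem (hB₁ h) (w₂.subset _ hl)).2
            · exact h
          have h0 := (ha₂ [] (w₂.root hv₂)).1
          exact (ha₂ l hl).2 r (h0.trans List.nil_prefix) hr'
      · by_cases hv₁ : v ∈ S₁
        · refine ⟨false :: a₁, ?_⟩
          rintro (_ | ⟨_ | _, l⟩) hl
          · exact absurd hl hv
          · refine ⟨by simpa using (ha₁ l hl).1, ?_⟩
            rintro (_ | ⟨_ | _, r⟩) h1 h2
            · simp at h1
            · exact (ha₁ l hl).2 r (by simpa using h1) (by simpa using h2)
            · simp at h1
          · exact absurd (Finset.mem_union_left _ (hmem hv₁ (w₂.subset _ hl)).1) hv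
        · refine ⟨true :: a₂, ?_⟩
          rintro (_ | ⟨_ | _, l⟩) hl
          · exact absurd hl hv
          · exact absurd (w₁.subset _ hl) hv₁
          · refine ⟨by simpa using (ha₂ l hl).1, ?_⟩
            rintro (_ | ⟨_ | _, r⟩) h1 h2
            · simp at h1
            · simp at h1
            · exact (ha₂ l hl).2 r (by simpa using h1) (by simpa using h2)

section TreeDist

variable {V : Type} {T : SimpleGraph V} (hT : T.IsTree) (w : Sym2 V → ℝ)

theorem isPath_treePath (u v : V) : (treePath hT u v).IsPath :=
  SimpleGraph.Path.isPath _

theorem eq_treePath {u v : V} {p : T.Walk u v} (hp : p.IsPath) : p = treePath hT u v :=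
  congrArg Subtype.val ((hT.isAcyclic.subsingleton_path u v).elim ⟨p, hp⟩ ⟨_, isPath_treePath hT u v⟩)

theorem treeDist_self (u : V) : treeDist hT w u u = 0 := by
  rw [treeDist, ← eq_treePath hT (SimpleGraph.Walk.IsPath.nil (u := u))]
  simp [walkWeight]

theorem treeDist_comm (u v : V) : treeDist hT w u v = treeDist hT w v u := by
  rw [treeDist, ← eq_treePath hT (isPath_treePath hT v u).reverse]
  simp [walkWeight, treeDist, List.sum_reverse]

theorem treeDist_eq_add {u v b : V} (hb : b ∈ (treePath hT u v).support) :
    treeDist hT w u v = treeDist hT w u b + treeDist hT w b v := by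
  classical
  have h1 := eq_treePath hT ((isPath_treePath hT u v).takeUntil hb)
  have h2 := eq_treePath hT ((isPath_treePath hT u v).dropUntil hb)
  have h3 : ∀ {x y z : V} (p : T.Walk x y) (q : T.Walk y z),
      walkWeight w (p.append q) = walkWeight w p + walkWeight w q := by
    simp [walkWeight]
  unfold treeDist
  rw [← h1, ← h2, ← h3, SimpleGraph.Walk.take_spec]

/-- The vertices in bags below an edge of the decomposition are separated from the others by the
two endpoints of this edge. -/
theorem exists_separator {W : List Bool → Finset V}
    (hE : ∀ u v, T.Adj u v → ∃ l, u ∈ W l ∧ v ∈ W l)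
    (htop : ∀ v, ∃ a, ∀ l, v ∈ W l → a <+: l ∧ ∀ r, a <+: r → r <+: l → v ∈ W r)
    {r l m : List Bool} {x y : V} (hx : x ∈ W l) (hy : y ∈ W m) (hl : r <+: l) (hm : ¬ r <+: m) :
    ∃ b, b ∈ W r ∧ b ∈ W r.dropLast ∧
      treeDist hT w x y = treeDist hT w x b + treeDist hT w b y := by
  have walk : ∀ {x y : V} (p : T.Walk x y), (∃ l, x ∈ W l ∧ r <+: l) →
      (∃ m, y ∈ W m ∧ ¬ r <+: m) →
      ∃ b ∈ p.support, (∃ l, b ∈ W l ∧ r <+: l) ∧ ∃ m, b ∈ W m ∧ ¬ r <+: m := by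
    intro x y p hx hy
    induction p with
    | nil => exact ⟨_, by simp, hx, hy⟩
    | cons h p ih =>
      obtain ⟨k, hk, hk'⟩ := hE _ _ h
      by_cases hr : r <+: k
      · obtain ⟨b, hb, h⟩ := ih ⟨k, hk', hr⟩ hy
        exact ⟨b, by simp [hb], h⟩
      · exact ⟨_, by simp, hx, k, hk, hr⟩
  obtain ⟨b, hb, ⟨l', hl', hrl⟩, m', hm', hrm⟩ :=
    walk (treePath hT x y) ⟨l, hx, hl⟩ ⟨m, hy, hm⟩
  obtain ⟨a, ha⟩ := htop b
  obtain ⟨hal, hal'⟩ := ha l' hl'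
  obtain ⟨ham, -⟩ := ha m' hm'
  have har : a <+: r := by
    rcases List.prefix_or_prefix_of_prefix hal hrl with h | h
    · exact h
    · exact absurd (h.trans ham) hrm
  have hne : a ≠ r := by
    rintro rfl
    exact hrm ham
  have hlen : a.length < r.length := by
    refine lt_of_le_of_ne har.length_le fun h => hne (har.eq_of_length h)
  refine ⟨b, hal' r har hrl, hal' _ ?_ ((List.dropLast_prefix r).trans hrl),
    treeDist_eq_add hT w hb⟩
  exact List.prefix_of_prefix_length_le har (List.dropLast_prefix r)
    (by rw [List.length_dropLast]; omega)

end TreeDist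

/-- The infinite binary tree, whose nodes are addressed by strings. -/
def stringTree : SimpleGraph (List Bool) where
  Adj l m := l ≠ m ∧ (m.dropLast = l ∨ l.dropLast = m)
  symm := ⟨fun _ _ h => ⟨h.1.symm, h.2.symm⟩⟩
  loopless := ⟨fun _ h => h.1 rfl⟩

theorem stringTree_adj_dropLast {l : List Bool} (hl : l ≠ []) : stringTree.Adj l l.dropLast := by
  refine ⟨fun h => ?_, Or.inr rfl⟩
  have := congrArg List.length h
  have := List.length_pos_iff.2 hl
  simp only [List.length_dropLast] at *
  omega

/-- A set of nodes of the binary tree that is closed under passing to the parent, except at one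
node, induces a connected subgraph. -/
theorem connected_induce_stringTree {Z : Set (List Bool)} (hZ : Z.Nonempty) (a : List Bool)
    (h : ∀ t ∈ Z, t ≠ a → t ≠ [] ∧ t.dropLast ∈ Z) : (stringTree.induce Z).Connected := by
  have key : ∀ (n : ℕ) (t : List Bool) (ht : t ∈ Z), t.length = n →
      ∃ ha : a ∈ Z, (stringTree.induce Z).Reachable ⟨t, ht⟩ ⟨a, ha⟩ := by
    intro n
    induction n with
    | zero =>
      intro t ht hn
      by_cases hta : t = a
      · subst hta
        exact ⟨ht, SimpleGraph.Reachable.refl _⟩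
      · exact absurd (List.length_eq_zero_iff.1 hn) (h t ht hta).1
    | succ n ih =>
      intro t ht hn
      by_cases hta : t = a
      · subst hta
        exact ⟨ht, SimpleGraph.Reachable.refl _⟩
      · obtain ⟨h1, h2⟩ := h t ht hta
        obtain ⟨ha, hr⟩ := ih t.dropLast h2 (by rw [List.length_dropLast]; omega)
        refine ⟨ha, SimpleGraph.Reachable.trans (SimpleGraph.Adj.reachable ?_) hr⟩
        exact stringTree_adj_dropLast h1
  rw [SimpleGraph.connected_iff]
  refine ⟨?_, hZ.to_subtype⟩
  rintro ⟨t, ht⟩ ⟨t', ht'⟩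
  obtain ⟨_, h1⟩ := key _ t ht rfl
  obtain ⟨_, h2⟩ := key _ t' ht' rfl
  exact h1.trans h2.symm

theorem isTree_stringTree : stringTree.IsTree := by
  constructor
  · have := connected_induce_stringTree (Z := Set.univ) Set.univ_nonempty []
      (fun t _ ht => ⟨ht, trivial⟩)
    exact (SimpleGraph.induceUnivIso stringTree).connected_iff.1 this
  · rw [SimpleGraph.isAcyclic_iff_forall_adj_isBridge]
    have main : ∀ l : List Bool, l ≠ [] → stringTree.IsBridge s(l, l.dropLast) := by
      intro l hl
      rw [SimpleGraph.isBridge_iff]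
      rintro ⟨p⟩
      obtain ⟨⟨⟨x, y⟩, hxy⟩, -, hx, hy⟩ := p.exists_boundary_dart {m | l <+: m} List.prefix_rfl
        (by
          intro h
          have := List.IsPrefix.length_le h
          have := List.length_pos_iff.2 hl
          simp only [List.length_dropLast] at *
          omega)
      simp only [Set.mem_ofPred_eq] at hx hy
      rw [SimpleGraph.deleteEdges_adj] at hxy
      obtain ⟨⟨-, h | h⟩, hne⟩ := hxy <;> dsimp only at h <;> subst h
      · exact hy (hx.trans (List.dropLast_prefix y))
      · rcases List.prefix_or_prefix_of_prefix hx (List.prefix_rfl (l := x)) with h | h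
        · by_cases hlx : l = x
          · subst hlx
            simp at hne
          · refine hy (List.prefix_of_prefix_length_le hx (List.dropLast_prefix x) ?_)
            have := lt_of_le_of_ne h.length_le fun h' => hlx (h.eq_of_length h')
            rw [List.length_dropLast]
            omega
        · obtain rfl := h.eq_of_length (le_antisymm h.length_le hx.length_le)
          simp at hne
    intro l m hlm
    obtain ⟨hne, h | h⟩ := hlm
    · subst h
      rw [Sym2.eq_swap]
      refine main m ?_
      rintro rfl
      exact hne rfl
    · subst h
      refine main l ?_
      rintro rfl
      exact hne rfl

/-- The strings of length at most `g`. -/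
def shortStrings : ℕ → Finset (List Bool)
  | 0 => {[]}
  | g + 1 => insert [] ((shortStrings g).image (List.cons false) ∪
      (shortStrings g).image (List.cons true))

theorem mem_shortStrings : ∀ {g : ℕ} {l : List Bool}, l ∈ shortStrings g ↔ l.length ≤ g
  | 0, l => by simp [shortStrings]
  | g + 1, [] => by simp [shortStrings]
  | g + 1, b :: l => by
    have := mem_shortStrings (g := g) (l := l)
    cases b <;> simp [shortStrings, this]

theorem card_shortStrings_lt : ∀ g : ℕ, (shortStrings g).card < 2 ^ (g + 1)
  | 0 => by simp [shortStrings]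
  | g + 1 => by
    have h := card_shortStrings_lt g
    have h1 := Finset.card_insert_le ([] : List Bool) ((shortStrings g).image (List.cons false) ∪
      (shortStrings g).image (List.cons true))
    have h2 := Finset.card_union_le ((shortStrings g).image (List.cons false))
      ((shortStrings g).image (List.cons true))
    have h3 := Finset.card_image_le (s := shortStrings g) (f := List.cons false)
    have h4 := Finset.card_image_le (s := shortStrings g) (f := List.cons true)
    rw [shortStrings, pow_succ]
    omega

/-- The levels whose bags are kept at level `q`: a multiple of `B ^ i` is kept for the next
`B ^ (i + 1)` levels. -/
def aliveLevels (h B q : ℕ) : Finset ℕ :=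
  (Finset.range (q + 1)).filter fun j => ∃ i < h, B ^ i ∣ j ∧ q ≤ j + B ^ (i + 1)

theorem mem_aliveLevels {h B q j : ℕ} :
    j ∈ aliveLevels h B q ↔ j ≤ q ∧ ∃ i < h, B ^ i ∣ j ∧ q ≤ j + B ^ (i + 1) := by
  simp [aliveLevels]

theorem card_aliveLevels_le {h B q : ℕ} (hB : 0 < B) :
    (aliveLevels h B q).card ≤ h * (B + 1) := by
  have hsub : aliveLevels h B q ⊆ (Finset.range h).biUnion fun i =>
      (Finset.range (B + 1)).image fun s => B ^ i * (q / B ^ i - s) := by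
    intro j hj
    obtain ⟨hjq, i, hi, ⟨c, rfl⟩, hq⟩ := mem_aliveLevels.1 hj
    have hpos : 0 < B ^ i := pow_pos hB i
    have h1 : c ≤ q / B ^ i := by
      rw [Nat.le_div_iff_mul_le hpos, mul_comm]
      exact hjq
    have h2 : q / B ^ i ≤ c + B := by
      rw [← Nat.mul_div_cancel_left (c + B) hpos]
      refine Nat.div_le_div_right (hq.trans_eq ?_)
      ring
    refine Finset.mem_biUnion.2 ⟨i, Finset.mem_range.2 hi, Finset.mem_image.2
      ⟨q / B ^ i - c, Finset.mem_range.2 (by omega), ?_⟩⟩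
    rw [Nat.sub_sub_self h1]
  refine (Finset.card_le_card hsub).trans ((Finset.card_biUnion_le_card_mul _ _ (B + 1) ?_).trans
    (by simp))
  intro i _
  exact Finset.card_image_le.trans (by simp)

section HopWalk

variable {V : Type}

/-- `HopWalk G d m u v ℓ`: there is a walk with `m` edges and length `ℓ` from `u` to `v`. -/
inductive HopWalk (G : SimpleGraph V) (d : V → V → ℝ) : ℕ → V → V → ℝ → Prop
  | nil (u : V) : HopWalk G d 0 u u 0
  | cons {m : ℕ} {u v b : V} {x : ℝ} (h : G.Adj u b) (p : HopWalk G d m b v x) :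
      HopWalk G d (m + 1) u v (d u b + x)

variable {G : SimpleGraph V} {d : V → V → ℝ}

theorem HopWalk.append {m m' : ℕ} {u b v : V} {x y : ℝ} (p : HopWalk G d m u b x)
    (q : HopWalk G d m' b v y) : HopWalk G d (m + m') u v (x + y) := by
  induction p with
  | nil => simpa using q
  | @cons m u b c x h p ih =>
    rw [add_assoc (d u c), Nat.add_right_comm m 1 m']
    exact .cons h (ih q)

theorem HopWalk.reverse (hd : ∀ u v, d u v = d v u) {m : ℕ} {u v : V} {x : ℝ}
    (p : HopWalk G d m u v x) : HopWalk G d m v u x := by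
  induction p with
  | nil => exact .nil _
  | @cons m u b c x h p ih =>
    have := ih.append (.cons h.symm (.nil u))
    rwa [add_zero, hd, add_comm x] at this

theorem HopWalk.exists_fin {m : ℕ} {u v : V} {ℓ : ℝ} (p : HopWalk G d m u v ℓ) :
    ∃ x : Fin (m + 1) → V, x 0 = u ∧ x (Fin.last m) = v ∧
      (∀ i : Fin m, G.Adj (x i.castSucc) (x i.succ)) ∧
      ∑ i : Fin m, d (x i.castSucc) (x i.succ) = ℓ := by
  induction p with
  | nil u => exact ⟨fun _ => u, rfl, rfl, fun i => i.elim0, by simp⟩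
  | @cons m u b c ℓ h p ih =>
    obtain ⟨x, h0, hl, ha, hs⟩ := ih
    refine ⟨Fin.cons u x, rfl, ?_, ?_, ?_⟩
    · rw [← Fin.succ_last, Fin.cons_succ, hl]
    · intro i
      refine Fin.cases ?_ (fun i => ?_) i
      · simpa [h0] using h
      · simpa [← Fin.succ_castSucc] using ha i
    · rw [Fin.sum_univ_succ]
      simp [h0, hs]

/-- There is a walk from `u` to `v` with at most `k` edges and length `d u v`. -/
def HopLE (G : SimpleGraph V) (d : V → V → ℝ) (k : ℕ) (u v : V) : Prop :=
  ∃ m ≤ k, HopWalk G d m u v (d u v)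

theorem HopLE.trans {k k' : ℕ} {u b v : V} (h : HopLE G d k u b) (h' : HopLE G d k' b v)
    (hd : d u v = d u b + d b v) : HopLE G d (k + k') u v := by
  obtain ⟨m, hm, p⟩ := h
  obtain ⟨m', hm', q⟩ := h'
  refine ⟨m + m', add_le_add hm hm', ?_⟩
  rw [hd]
  exact p.append q

theorem HopLE.mono {k k' : ℕ} {u v : V} (h : HopLE G d k u v) (hk : k ≤ k') :
    HopLE G d k' u v := by
  obtain ⟨m, hm, p⟩ := h
  exact ⟨m, hm.trans hk, p⟩

theorem HopLE.symm {k : ℕ} {u v : V} (hd : ∀ u v, d u v = d v u) (h : HopLE G d k u v) :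
    HopLE G d k v u := by
  obtain ⟨m, hm, p⟩ := h
  refine ⟨m, hm, ?_⟩
  rw [hd]
  exact p.reverse hd

theorem HopLE.refl (hd : ∀ u, d u u = 0) (k : ℕ) (u : V) : HopLE G d k u u := by
  refine ⟨0, Nat.zero_le k, ?_⟩
  rw [hd]
  exact .nil u

/-- The graph in which each bag is a clique. -/
def bagGraph (bag : List Bool → Finset V) : SimpleGraph V where
  Adj u v := u ≠ v ∧ ∃ t, u ∈ bag t ∧ v ∈ bag t
  symm := ⟨fun _ _ h => ⟨h.1.symm, h.2.imp fun _ ht => ht.symm⟩⟩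
  loopless := ⟨fun _ h => h.1 rfl⟩

theorem HopLE.of_mem_bag {bag : List Bool → Finset V} (hd : ∀ u, d u u = 0) {t : List Bool}
    {u v : V} (hu : u ∈ bag t) (hv : v ∈ bag t) : HopLE (bagGraph bag) d 1 u v := by
  by_cases huv : u = v
  · subst huv
    exact .refl hd 1 u
  · refine ⟨1, le_rfl, ?_⟩
    have := HopWalk.cons (d := d) (show (bagGraph bag).Adj u v from ⟨huv, t, hu, hv⟩) (.nil v)
    rwa [add_zero] at this

theorem isOneSpannerHop_of_hopLE {k : ℕ} (h : ∀ u v, HopLE G d k u v) :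
    IsOneSpannerHop G d k := by
  intro u v
  obtain ⟨m, hm, p⟩ := h u v
  obtain ⟨x, hx⟩ := p.exists_fin
  exact ⟨m, x, hm, hx⟩

end HopWalk

section Spread

variable {V : Type} [DecidableEq V] {W : List Bool → Finset V} {g h B : ℕ}

/-- The bags of the shortcutting: levels are grouped into blocks of height `g`. The bag at `t`
consists of the bags `W` in the top part of its block, and of the bags `W` at those block
boundaries above `t` that are still alive. -/
def spreadBag (W : List Bool → Finset V) (g h B : ℕ) (t : List Bool) : Finset V :=
  ((shortStrings g).biUnion fun s => W (t.take (g * (t.length / g)) ++ s)) ∪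
    (aliveLevels h B (t.length / g)).biUnion fun j => W (t.take (g * j))

theorem mem_spreadBag {t : List Bool} {v : V} :
    v ∈ spreadBag W g h B t ↔
      (∃ s : List Bool, s.length ≤ g ∧ v ∈ W (t.take (g * (t.length / g)) ++ s)) ∨
      ∃ j, (j ≤ t.length / g ∧ ∃ i < h, B ^ i ∣ j ∧ t.length / g ≤ j + B ^ (i + 1)) ∧
        v ∈ W (t.take (g * j)) := by
  simp only [spreadBag, Finset.mem_union, Finset.mem_biUnion, mem_shortStrings, mem_aliveLevels]

theorem card_spreadBag_le (hW : ∀ l, (W l).card ≤ 4) (hB : 0 < B) (t : List Bool) :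
    (spreadBag W g h B t).card ≤ 4 * 2 ^ (g + 1) + 4 * (h * (B + 1)) := by
  refine (Finset.card_union_le _ _).trans (add_le_add ?_ ?_)
  · refine (Finset.card_biUnion_le_card_mul _ _ 4 fun _ _ => hW _).trans ?_
    have := card_shortStrings_lt g
    omega
  · refine (Finset.card_biUnion_le_card_mul _ _ 4 fun _ _ => hW _).trans ?_
    have := card_aliveLevels_le (h := h) (q := t.length / g) hB
    omega

theorem mem_spreadBag_of_length_le {t p : List Bool} {v : V} (hv : v ∈ W p)
    (h1 : t.take (g * (t.length / g)) <+: p) (h2 : p.length ≤ g * (t.length / g) + g) :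
    v ∈ spreadBag W g h B t := by
  obtain ⟨s, rfl⟩ := h1
  refine mem_spreadBag.2 (Or.inl ⟨s, ?_, hv⟩)
  have := Nat.mul_div_le t.length g
  simp only [List.length_append, List.length_take] at h2
  omega

theorem mem_spreadBag_self (hg : 0 < g) {t : List Bool} {v : V} (hv : v ∈ W t) :
    v ∈ spreadBag W g h B t :=
  mem_spreadBag_of_length_le hv (List.take_prefix _ _)
    (Nat.lt_mul_div_succ t.length hg).le

theorem mem_spreadBag_of_alive {t : List Bool} {v : V} {i j : ℕ} (hj : j ≤ t.length / g)
    (hi : i < h) (hd : B ^ i ∣ j) (ht : t.length / g ≤ j + B ^ (i + 1))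
    (hv : v ∈ W (t.take (g * j))) : v ∈ spreadBag W g h B t :=
  mem_spreadBag.2 (Or.inr ⟨j, ⟨hj, i, hi, hd, ht⟩, hv⟩)

theorem mem_spreadBag_dropLast (hg : 0 < g) {a t : List Bool} {v : V}
    (ha : ∀ l, v ∈ W l → a <+: l ∧ ∀ r, a <+: r → r <+: l → v ∈ W r)
    (hv : v ∈ spreadBag W g h B t)
    (hta : t ≠ a.dropLast.take (g * (a.dropLast.length / g))) :
    t ≠ [] ∧ v ∈ spreadBag W g h B t.dropLast := by
  have hlen := Nat.mul_div_le t.length g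
  have hlt := Nat.lt_mul_div_succ t.length hg
  have short : ∀ s : List Bool, s.length ≤ g → v ∈ W (t.take (g * (t.length / g)) ++ s) →
      t ≠ [] ∧ v ∈ spreadBag W g h B t.dropLast := by
    intro s hs hv
    by_cases hgt : g ∣ t.length
    · rw [Nat.mul_div_cancel' hgt, List.take_length] at hv
      obtain ⟨ha1, ha2⟩ := ha _ hv
      rcases lt_or_ge a.length t.length with hat | hat
      · refine ⟨List.ne_nil_of_length_pos (by omega), mem_spreadBag_self hg (ha2 _ ?_ ?_)⟩
        · refine List.prefix_of_prefix_length_le ha1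
            ((List.dropLast_prefix t).trans (List.prefix_append t s)) ?_
          rw [List.length_dropLast]
          omega
        · exact (List.dropLast_prefix t).trans (List.prefix_append t s)
      · have hta' : t <+: a := List.prefix_of_prefix_length_le (List.prefix_append t s) ha1 hat
        rcases hat.eq_or_lt with heq | hlt'
        · obtain rfl := hta'.eq_of_length heq
          have hne : t ≠ [] := by
            rintro rfl
            simp at hta
          have hpos := List.length_pos_iff.2 hne
          refine ⟨hne, mem_spreadBag_of_length_le (ha2 _ List.prefix_rfl ha1)
            ((List.take_prefix _ _).trans (List.dropLast_prefix t)) ?_⟩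
          have := Nat.lt_mul_div_succ t.dropLast.length hg
          rw [mul_add, mul_one] at this
          simp only [List.length_dropLast] at this ⊢
          omega
        · exfalso
          apply hta
          have ha3 := ha1.length_le
          rw [List.length_append] at ha3
          have hq : a.dropLast.length / g = t.length / g := by
            rw [List.length_dropLast]
            refine Nat.div_eq_of_lt_le ?_ ?_
            · rw [Nat.div_mul_cancel hgt]
              omega
            · rw [Nat.succ_mul, Nat.div_mul_cancel hgt]
              omega
          rw [hq, Nat.mul_div_cancel' hgt]
          have : t <+: a.dropLast := by
            refine List.prefix_of_prefix_length_le hta' (List.dropLast_prefix a) ?_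
            rw [List.length_dropLast]
            omega
          exact List.prefix_iff_eq_take.1 this
    · have hne : t ≠ [] := by
        rintro rfl
        simp at hgt
      have h1 : g * (t.length / g) < t.length :=
        lt_of_le_of_ne hlen fun h' => hgt ⟨_, h'.symm⟩
      have hq : t.dropLast.length / g = t.length / g := by
        rw [List.length_dropLast]
        refine Nat.div_eq_of_lt_le ?_ ?_
        · rw [mul_comm]
          omega
        · rw [mul_comm]
          exact (Nat.sub_le _ _).trans_lt hlt
      refine ⟨hne, mem_spreadBag.2 (Or.inl ⟨s, hs, ?_⟩)⟩
      rw [hq, List.dropLast_eq_take, List.take_take, min_eq_left (by omega)]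
      exact hv
  rcases mem_spreadBag.1 hv with ⟨s, hs, hv⟩ | ⟨j, ⟨hj, i, hi, hd, hq⟩, hv⟩
  · exact short s hs hv
  · have hjt : g * j ≤ t.length := (Nat.mul_le_mul_left g hj).trans hlen
    rcases hjt.eq_or_lt with heq | hlt'
    · refine short [] (Nat.zero_le g) ?_
      rw [heq, List.take_length] at hv
      rw [← heq, Nat.mul_div_cancel_left _ hg, heq, List.take_length, List.append_nil]
      exact hv
    · refine ⟨List.ne_nil_of_length_pos (by omega), mem_spreadBag_of_alive ?_ hi hd ?_ ?_⟩
      · rw [Nat.le_div_iff_mul_le hg, List.length_dropLast, mul_comm]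
        omega
      · refine le_trans (Nat.div_le_div_right ?_) hq
        rw [List.length_dropLast]
        exact Nat.sub_le _ _
      · rw [List.dropLast_eq_take, List.take_take, min_eq_left (by omega)]
        exact hv

/-- The shortcutting has the tree decomposition with bags `spreadBag W g h B`. -/
theorem treewidthLE_bagGraph (hg : 0 < g) (hB : 0 < B) (hW : ∀ l, (W l).card ≤ 4)
    (hV : ∀ v, ∃ l, v ∈ W l)
    (htop : ∀ v, ∃ a, ∀ l, v ∈ W l → a <+: l ∧ ∀ r, a <+: r → r <+: l → v ∈ W r) {r : ℝ}
    (hr : 8 * (2 : ℝ) ^ g + 4 * (h * (B + 1)) ≤ r) :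
    TreewidthLE (bagGraph (spreadBag W g h B)) r := by
  have hmem : ∀ v, ∃ t, v ∈ spreadBag W g h B t := fun v =>
    (hV v).imp fun _ hv => mem_spreadBag_self hg hv
  refine ⟨List Bool, ⟨stringTree, isTree_stringTree, spreadBag W g h B, hmem,
    fun u v huv => huv.2, fun v => ?_⟩, fun t => ?_⟩
  · obtain ⟨a, ha⟩ := htop v
    exact connected_induce_stringTree (hmem v) _ fun t ht hta =>
      mem_spreadBag_dropLast hg ha ht hta
  · have h1 : ((spreadBag W g h B t).card : ℝ) ≤ 4 * 2 ^ (g + 1) + 4 * (h * (B + 1)) := by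
      exact_mod_cast card_spreadBag_le hW hB t
    rw [pow_succ] at h1
    dsimp only
    linarith

variable {d : V → V → ℝ}

/-- From any bag above `t`, a bag at a block boundary divisible by `B ^ i` reaches the vertices at
`t` in `h - i` hops. -/
theorem hopLE_of_mem_take (hg : 0 < g) (hB : 0 < B) (hself : ∀ u, d u u = 0)
    (hcomm : ∀ u v, d u v = d v u)
    (hsep : ∀ (r l m : List Bool) (x y : V), x ∈ W l → y ∈ W m → r <+: l → ¬ r <+: m →
      ∃ b, b ∈ W r ∧ b ∈ W r.dropLast ∧ d x y = d x b + d b y)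
    {t : List Bool} {u : V} (hu : u ∈ W t) (hm : t.length / g < B ^ h) (r : ℕ) :
    ∀ (i j : ℕ) (z : V), i + (r + 1) = h → B ^ i ∣ j → j ≤ t.length / g →
      z ∈ W (t.take (g * j)) → HopLE (bagGraph (spreadBag W g h B)) d (r + 1) z u := by
  induction r with
  | zero =>
    intro i j z hi hd hj hz
    refine .of_mem_bag hself (t := t) (mem_spreadBag_of_alive hj (by omega) hd ?_ hz)
      (mem_spreadBag_self hg hu)
    rw [hi]
    omega
  | succ r ih =>
    intro i j z hi hd hj hz
    by_cases hq : t.length / g ≤ j + B ^ (i + 1)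
    · exact (HopLE.of_mem_bag hself (t := t) (mem_spreadBag_of_alive hj (by omega) hd hq hz)
        (mem_spreadBag_self hg hu)).mono (by omega)
    · have hpos : 0 < B ^ (i + 1) := pow_pos hB _
      set j' := B ^ (i + 1) * (j / B ^ (i + 1) + 1) with hj'
      have h1 : j < j' := Nat.lt_mul_div_succ j hpos
      have h2 : j' ≤ j + B ^ (i + 1) := by
        have := Nat.mul_div_le j (B ^ (i + 1))
        rw [hj', mul_add, mul_one]
        omega
      have h3 : g * j' ≤ t.length := by
        rw [mul_comm, ← Nat.le_div_iff_mul_le hg]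
        omega
      have h4 : g * j < g * j' := Nat.mul_lt_mul_of_pos_left h1 hg
      obtain ⟨z', hz', -, hdist⟩ := hsep (t.take (g * j')) t (t.take (g * j)) u z hu hz
        (List.take_prefix _ _) fun hp => by
          have := hp.length_le
          simp only [List.length_take] at this
          omega
      have hlen : (t.take (g * j')).length / g = j' := by
        rw [List.length_take, min_eq_left h3, Nat.mul_div_cancel_left _ hg]
      have hop : HopLE (bagGraph (spreadBag W g h B)) d 1 z z' := by
        refine .of_mem_bag hself (t := t.take (g * j')) (mem_spreadBag_of_alive (i := i) (j := j)
          (by omega) (by omega) hd (by omega) ?_) (mem_spreadBag_self hg hz')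
        rw [List.take_take, min_eq_left h4.le]
        exact hz
      have := hop.trans (ih (i + 1) j' z' (by omega) ⟨_, hj'⟩ (by omega) hz')
        (by rw [hcomm z u, hcomm z z', hcomm z' u, hdist, add_comm])
      rwa [add_comm] at this

end Spread

/-- Two strings have a longest common prefix. -/
theorem exists_longest_common_prefix : ∀ l m : List Bool,
    ∃ p, p <+: l ∧ p <+: m ∧ ∀ q, q <+: l → q <+: m → q <+: p
  | [], m => ⟨[], List.prefix_rfl, List.nil_prefix, fun _ h _ => h⟩
  | b :: l, [] => ⟨[], List.nil_prefix, List.prefix_rfl, fun _ _ h => h⟩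
  | b :: l, c :: m => by
    by_cases hbc : b = c
    · subst hbc
      obtain ⟨p, h1, h2, h3⟩ := exists_longest_common_prefix l m
      refine ⟨b :: p, List.cons_prefix_cons.2 ⟨rfl, h1⟩, List.cons_prefix_cons.2 ⟨rfl, h2⟩, ?_⟩
      rintro (_ | ⟨a, q⟩) hq hq'
      · exact List.nil_prefix
      · rw [List.cons_prefix_cons] at *
        exact ⟨hq.1, h3 q hq.2 hq'.2⟩
    · refine ⟨[], List.nil_prefix, List.nil_prefix, ?_⟩
      rintro (_ | ⟨a, q⟩) hq hq'
      · exact List.nil_prefix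
      · rw [List.cons_prefix_cons] at hq hq'
        exact absurd (hq.1.symm.trans hq'.1) hbc

section HopBound

variable {V : Type} [DecidableEq V] {W : List Bool → Finset V} {g h B : ℕ} {d : V → V → ℝ}

/-- With blocks of height one, all pairs are connected in `2 * h` hops. -/
theorem hopLE_two_mul (hh : 0 < h) (hB : 0 < B) (hself : ∀ u, d u u = 0)
    (hcomm : ∀ u v, d u v = d v u)
    (hsep : ∀ (r l m : List Bool) (x y : V), x ∈ W l → y ∈ W m → r <+: l → ¬ r <+: m →
      ∃ b, b ∈ W r ∧ b ∈ W r.dropLast ∧ d x y = d x b + d b y)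
    (hV : ∀ v, ∃ l, v ∈ W l) (hdepth : ∀ l, (W l).Nonempty → l.length < B ^ h) (u v : V) :
    HopLE (bagGraph (spreadBag W 1 h B)) d (2 * h) u v := by
  obtain ⟨r, rfl⟩ : ∃ r, h = r + 1 := ⟨h - 1, by omega⟩
  obtain ⟨t, hu⟩ := hV u
  obtain ⟨t', hv⟩ := hV v
  obtain ⟨p, hp, hp', hmax⟩ := exists_longest_common_prefix t t'
  have hop : ∀ {l : List Bool} {x z : V}, x ∈ W l → p <+: l → z ∈ W p →
      HopLE (bagGraph (spreadBag W 1 (r + 1) B)) d (r + 1) z x := by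
    intro l x z hx hpl hz
    have hlen := hdepth l ⟨x, hx⟩
    refine hopLE_of_mem_take one_pos hB hself hcomm hsep hx (by simpa using hlen) r 0 p.length z
      (by omega) (by simp) (by simpa using hpl.length_le) ?_
    rwa [one_mul, ← List.prefix_iff_eq_take.1 hpl]
  obtain ⟨z, hz, hd⟩ : ∃ z ∈ W p, d u v = d u z + d z v := by
    obtain ⟨s, rfl⟩ := hp
    rcases s with _ | ⟨b, s⟩
    · rw [List.append_nil] at hu
      exact ⟨u, hu, by rw [hself, zero_add]⟩
    · have hpre : p ++ [b] <+: p ++ b :: s := ⟨s, by simp⟩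
      obtain ⟨z, -, hz, hd⟩ := hsep (p ++ [b]) _ t' u v hu hv hpre fun hb => by
        simpa using (hmax _ hpre hb).length_le
      rw [List.dropLast_concat] at hz
      exact ⟨z, hz, hd⟩
  exact (((hop hu hp hz).symm hcomm).trans (hop hv hp' hz) hd).mono (by omega)

/-- With blocks of arbitrary height, all pairs are connected in `2 * h + 1` hops. -/
theorem hopLE_two_mul_add_one (hg : 0 < g) (hh : 0 < h) (hB : 0 < B) (hself : ∀ u, d u u = 0)
    (hcomm : ∀ u v, d u v = d v u)
    (hsep : ∀ (r l m : List Bool) (x y : V), x ∈ W l → y ∈ W m → r <+: l → ¬ r <+: m →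
      ∃ b, b ∈ W r ∧ b ∈ W r.dropLast ∧ d x y = d x b + d b y)
    (hV : ∀ v, ∃ l, v ∈ W l) (hdepth : ∀ l, (W l).Nonempty → l.length / g < B ^ h) (u v : V) :
    HopLE (bagGraph (spreadBag W g h B)) d (2 * h + 1) u v := by
  obtain ⟨r, rfl⟩ : ∃ r, h = r + 1 := ⟨h - 1, by omega⟩
  obtain ⟨t, hu⟩ := hV u
  obtain ⟨t', hv⟩ := hV v
  obtain ⟨p, hp, hp', hmax⟩ := exists_longest_common_prefix t t'
  have exitPoint : ∀ {l m : List Bool} {x y : V}, x ∈ W l → y ∈ W m → p <+: l →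
      (∀ q, q <+: l → q <+: m → q <+: p) → ∃ z k, z ∈ spreadBag W g (r + 1) B p ∧ z ∈ W k ∧
        k <+: l ∧ HopLE (bagGraph (spreadBag W g (r + 1) B)) d (r + 1) z x ∧
        d x y = d x z + d z y := by
    intro l m x y hx hy hpl hmax
    by_cases hlen : l.length < g * (p.length / g + 1)
    · exact ⟨x, l, mem_spreadBag_of_length_le hx ((List.take_prefix _ _).trans hpl)
        (by rw [← mul_add_one]; exact hlen.le), hx, List.prefix_rfl, .refl hself _ _,
        by rw [hself, zero_add]⟩
    · rw [not_lt] at hlen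
      have hlt := Nat.lt_mul_div_succ p.length hg
      have hk := List.take_prefix (g * (p.length / g + 1)) l
      have hkl : (l.take (g * (p.length / g + 1))).length = g * (p.length / g + 1) := by
        rw [List.length_take, min_eq_left hlen]
      obtain ⟨z, hz, -, hd⟩ := hsep _ l m x y hx hy hk fun hkm => by
        have := (hmax _ hk hkm).length_le
        omega
      refine ⟨z, _, mem_spreadBag_of_length_le hz ?_ (by rw [hkl, mul_add_one]), hz, hk,
        hopLE_of_mem_take hg hB hself hcomm hsep hx (hdepth l ⟨x, hx⟩) r 0 _ z (by omega)
          (by simp) ?_ hz, hd⟩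
      · exact (List.take_prefix _ _).trans
          (List.prefix_of_prefix_length_le hpl hk (by rw [hkl]; exact hlt.le))
      · rw [Nat.le_div_iff_mul_le hg, mul_comm]
        exact hlen
  obtain ⟨z, k, hzp, hz, hk, hop, hd⟩ := exitPoint hu hv hp hmax
  obtain ⟨z', -, hzp', -, -, hop', hd'⟩ := exitPoint hv hz hp'
    fun q hq hqk => hmax q (hqk.trans hk) hq
  have := (hop.symm hcomm).trans ((HopLE.of_mem_bag hself hzp hzp').trans hop'
    (by rw [hcomm z v, hd', hcomm v z', hcomm z' z, add_comm])) hd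
  exact this.mono (by omega)

end HopBound

/-- A tree has a binary tree decomposition of logarithmic depth with bags of size at most four. -/
theorem exists_shallow_labelling {V : Type} [Fintype V] [DecidableEq V] {T : SimpleGraph V}
    (hT : T.IsTree) : ∃ W, (∀ u v, T.Adj u v → ∃ l, u ∈ W l ∧ v ∈ W l) ∧
      ∃ E B, IsLabelling Finset.univ E B (4 * Nat.clog 2 (Fintype.card V)) W := by
  obtain ⟨t, ht, hverts, hedges⟩ := exists_joinTree hT
  have hsize : t.size ≤ 2 ^ Nat.clog 2 (Fintype.card V) := by
    rw [← ht.card_verts, hverts]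
    exact Nat.le_pow_clog one_lt_two _
  obtain ⟨-, W, hW⟩ := ((JoinTree.exists_cluster _).1 t ht hsize).exists_isLabelling
  rw [hverts] at hW
  refine ⟨W, fun u v huv => ?_, _, _, hW⟩
  exact (hW.exists_edge _ (hedges u v huv)).imp fun l hl => ⟨hl u (by simp), hl v (by simp)⟩

theorem four_mul_clog_le {n : ℕ} (hn : 4 ≤ n) :
    2 ≤ Real.logb 2 n ∧ ((4 * Nat.clog 2 n : ℕ) : ℝ) ≤ 6 * Real.logb 2 n := by
  have h2 : (2 : ℝ) ≤ Real.logb 2 n := by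
    rw [Real.le_logb_iff_rpow_le one_lt_two (by positivity)]
    norm_num
    exact hn
  refine ⟨h2, ?_⟩
  have h3 : (Nat.clog 2 n : ℝ) ≤ Real.logb 2 n + 1 := by
    have : Nat.clog 2 n = ⌈Real.logb 2 n⌉₊ := by
      simpa using (Real.natCeil_logb_natCast 2 n).symm
    rw [this]
    exact (Nat.ceil_lt_add_one (by linarith)).le
  push_cast
  linarith

theorem exists_base_even {h D : ℕ} {L : ℝ} (hh : 0 < h) (hL : 1 ≤ L) (hD : (D : ℝ) ≤ 6 * L) :
    ∃ B : ℕ, 0 < B ∧ D < B ^ h ∧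
      8 * (2 : ℝ) ^ 1 + 4 * (h * (B + 1)) ≤ 100 * (2 * h) * L ^ (1 / (h : ℝ)) := by
  have hh' : (1 : ℝ) ≤ h := by exact_mod_cast hh
  set Y := L ^ (1 / (h : ℝ)) with hY
  have hY1 : 1 ≤ Y := Real.one_le_rpow hL (by positivity)
  have hYh : Y ^ h = L := by
    rw [hY, one_div]
    exact Real.rpow_inv_natCast_pow (by linarith) hh.ne'
  have hceil := Nat.le_ceil Y
  have hceil' := (Nat.ceil_lt_add_one (by linarith : 0 ≤ Y)).le
  refine ⟨7 * ⌈Y⌉₊, by have := Nat.ceil_pos.2 (by linarith : 0 < Y); omega, ?_, ?_⟩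
  · rw [← Nat.cast_lt (α := ℝ)]
    push_cast
    have h1 : (7 : ℝ) ≤ 7 ^ h := le_self_pow₀ (by norm_num) hh.ne'
    have h2 : Y ^ h ≤ (⌈Y⌉₊ : ℝ) ^ h := pow_le_pow_left₀ (by linarith) hceil h
    rw [mul_pow]
    nlinarith
  · push_cast
    have h1 : (7 * (⌈Y⌉₊ : ℝ) + 1) ≤ 15 * Y := by linarith
    have h2 : (h : ℝ) * (7 * (⌈Y⌉₊ : ℝ) + 1) ≤ h * (15 * Y) := by gcongr
    have h3 : 1 ≤ h * Y := one_le_mul_of_one_le_of_one_le hh' hY1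
    nlinarith

theorem exists_base_odd {h D : ℕ} {L : ℝ} (hh : 0 < h) (hL : 2 ≤ L) (hD : (D : ℝ) ≤ 6 * L) :
    ∃ g B : ℕ, 0 < g ∧ 0 < B ∧ D < B ^ h * g ∧
      8 * (2 : ℝ) ^ g + 4 * (h * (B + 1)) ≤
        100 * (2 * h + 1) * (L / Real.logb 2 L) ^ (1 / (h : ℝ)) := by
  have hh' : (1 : ℝ) ≤ h := by exact_mod_cast hh
  have hself : ∀ x : ℝ, 0 < x → Real.logb 2 x ≤ x := by
    intro x hx
    rw [Real.logb_le_iff_le_rpow one_lt_two hx]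
    rcases le_or_gt 1 x with h | h
    · have := one_add_mul_self_le_rpow_one_add (s := 1) (by norm_num) h
      norm_num at this
      linarith
    · exact h.le.trans (Real.one_le_rpow one_le_two hx.le)
  set lam := Real.logb 2 L with hlam
  have hlam1 : 1 ≤ lam := by
    rw [hlam, Real.le_logb_iff_rpow_le one_lt_two (by linarith)]
    simpa using hL
  have hpow : (2 : ℝ) ^ lam = L := Real.rpow_logb (by norm_num) (by norm_num) (by linarith)
  set X := L / lam with hX
  have hXL : X * lam = L := div_mul_cancel₀ _ (by linarith)
  have hX1 : 1 ≤ X := by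
    rw [hX, le_div_iff₀ (by linarith), one_mul]
    exact hself L (by linarith)
  have hsqrt : lam ≤ 2 * √L := by
    have := hself (√L) (by positivity)
    rw [Real.sqrt_eq_rpow, Real.logb_rpow_eq_mul_logb_of_pos (by linarith), ← hlam,
      ← Real.sqrt_eq_rpow] at this
    linarith
  have hsqrt' : √L ≤ 2 * X := by
    have h1 : √L * √L = L := Real.mul_self_sqrt (by linarith)
    have h2 : 0 < √L := by positivity
    nlinarith
  set Y := X ^ (1 / (h : ℝ)) with hY
  have hY1 : 1 ≤ Y := Real.one_le_rpow hX1 (by positivity)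
  have hYh : Y ^ h = X := by
    rw [hY, one_div]
    exact Real.rpow_inv_natCast_pow (by linarith) hh.ne'
  have hceil := Nat.le_ceil Y
  have hceil' := (Nat.ceil_lt_add_one (by linarith : 0 ≤ Y)).le
  set μ := lam / (2 * h) with hμ
  have hμ0 : 0 ≤ μ := by positivity
  have hμh : μ * (2 * h) = lam := div_mul_cancel₀ _ (by positivity)
  have hg : (2 : ℝ) ^ (⌊μ⌋₊ + 1) ≤ 4 * Y := by
    have h1 : (2 : ℝ) ^ ⌊μ⌋₊ ≤ 2 ^ μ := by
      rw [← Real.rpow_natCast]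
      exact Real.rpow_le_rpow_of_exponent_le one_le_two (Nat.floor_le hμ0)
    have h2 : (2 : ℝ) ^ μ = √L ^ (1 / (h : ℝ)) := by
      rw [Real.sqrt_eq_rpow, ← hpow, ← Real.rpow_mul (by positivity),
        ← Real.rpow_mul (by positivity), hμ]
      congr 1
      field_simp
    have h3 : √L ^ (1 / (h : ℝ)) ≤ (2 * X) ^ (1 / (h : ℝ)) :=
      Real.rpow_le_rpow (by positivity) hsqrt' (by positivity)
    have h4 : (2 : ℝ) ^ (1 / (h : ℝ)) ≤ 2 := by
      refine (Real.rpow_le_rpow_of_exponent_le one_le_two ?_).trans_eq (Real.rpow_one 2)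
      rw [div_le_one (by linarith)]
      exact hh'
    rw [Real.mul_rpow (by norm_num) (by linarith), ← hY] at h3
    have h5 : (2 : ℝ) ^ (1 / (h : ℝ)) * Y ≤ 2 * Y := by gcongr
    rw [pow_succ]
    linarith
  refine ⟨⌊μ⌋₊ + 1, 13 * ⌈Y⌉₊, Nat.succ_pos _,
    by have := Nat.ceil_pos.2 (by linarith : 0 < Y); omega, ?_, ?_⟩
  · rw [← Nat.cast_lt (α := ℝ)]
    push_cast
    have h1 : 1 + (h : ℝ) * 12 ≤ 13 ^ h := by
      have := one_add_mul_le_pow (a := (12 : ℝ)) (by norm_num) h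
      norm_num at this
      linarith
    have h2 : Y ^ h ≤ (⌈Y⌉₊ : ℝ) ^ h := pow_le_pow_left₀ (by linarith) hceil h
    rw [mul_pow]
    rw [hYh] at h2
    calc (D : ℝ) ≤ 6 * L := hD
      _ = (h * 12 * X) * μ := by rw [← hXL, ← hμh]; ring
      _ < (h * 12 * X) * (⌊μ⌋₊ + 1) := by
        have := Nat.lt_floor_add_one μ
        gcongr
      _ ≤ (13 ^ h * (⌈Y⌉₊ : ℝ) ^ h) * (⌊μ⌋₊ + 1) := by
        gcongr
        linarith
  · push_cast
    have h1 : (13 * (⌈Y⌉₊ : ℝ) + 1) ≤ 27 * Y := by linarith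
    have h2 : (h : ℝ) * (13 * (⌈Y⌉₊ : ℝ) + 1) ≤ h * (27 * Y) := by gcongr
    have h3 : Y ≤ h * Y := le_mul_of_one_le_left (by linarith) hh'
    nlinarith

/-- There is an absolute constant `c > 0` such that for every integer
`n ≥ 4` and every integer `k` with `2 ≤ k ≤ c·log log n`, every `n`-vertex edge-weighted
tree admits a shortcutting with hop-diameter `k` whose treewidth is at most
`c·k·(log n)^{2/k}` when `k` is even, and at most `c·k·(log n / log log n)^{2/(k-1)}`
when `k` is odd. -/
theorem stmt0 :
    ∃ c : ℝ, 0 < c ∧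
      ∀ n : ℕ, 4 ≤ n → ∀ k : ℕ, 2 ≤ k →
        (k : ℝ) ≤ c * Real.logb 2 (Real.logb 2 n) →
        ∀ (V : Type) (_ : Fintype V), Fintype.card V = n →
          ∀ (T : SimpleGraph V) (hT : T.IsTree) (w : Sym2 V → ℝ),
            (∀ e ∈ T.edgeSet, 0 < w e) →
            ∃ G' : SimpleGraph V,
              IsOneSpannerHop G' (treeDist hT w) k ∧
              (Even k → TreewidthLE G' (c * k * Real.logb 2 n ^ ((2 : ℝ) / k))) ∧
              (Odd k → TreewidthLE G'
                (c * k * (Real.logb 2 n / Real.logb 2 (Real.logb 2 n)) ^ ((2 : ℝ) / ((k : ℝ) - 1)))) := by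
  refine ⟨100, by norm_num, fun n hn k hk _ V _ hV T hT w _ => ?_⟩
  classical
  obtain ⟨W, hE, E, S, hW⟩ := exists_shallow_labelling hT
  rw [hV] at hW
  obtain ⟨hL, hD⟩ := four_mul_clog_le hn
  have hsep := fun (r l m : List Bool) (x y : V) (hx : x ∈ W l) (hy : y ∈ W m) (hl : r <+: l)
    (hm : ¬ r <+: m) => exists_separator hT w hE hW.exists_top hx hy hl hm
  have hmem : ∀ v, ∃ l, v ∈ W l := fun v => hW.exists_mem v (Finset.mem_univ v)
  rcases Nat.even_or_odd' k with ⟨h, rfl | rfl⟩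
  · have hh : 0 < h := by omega
    obtain ⟨B, hB, hDB, hr⟩ := exists_base_even hh (by linarith) hD
    refine ⟨bagGraph (spreadBag W 1 h B), isOneSpannerHop_of_hopLE
      (hopLE_two_mul hh hB (treeDist_self hT w) (treeDist_comm hT w) hsep hmem
        fun l hl => (hW.length_le l hl).trans_lt hDB),
      fun _ => treewidthLE_bagGraph one_pos hB hW.card_le hmem hW.exists_top (hr.trans_eq ?_),
      fun hodd => absurd hodd (by simp)⟩
    push_cast
    congr 2
    field_simp
  · have hh : 0 < h := by omega
    obtain ⟨g, B, hg, hB, hDB, hr⟩ := exists_base_odd hh hL hD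
    refine ⟨bagGraph (spreadBag W g h B), isOneSpannerHop_of_hopLE
      (hopLE_two_mul_add_one hg hh hB (treeDist_self hT w) (treeDist_comm hT w) hsep hmem
        fun l hl => (Nat.div_lt_iff_lt_mul hg).2 ((hW.length_le l hl).trans_lt hDB)),
      fun heven => absurd heven (by simp),
      fun _ => treewidthLE_bagGraph hg hB hW.card_le hmem hW.exists_top (hr.trans_eq ?_)⟩
    push_cast
    congr 2
    rw [add_sub_cancel_right]
    field_simp
end

section
/- There is an absolute constant c > 0 such that for every n ≥ 4, every edge-weighted tree T on n vertices admits a shortcutting with hop-diameter 3 and treewidth at most c·log n / log log n. -/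
open SimpleGraph

namespace TreeShortcut

/-- `s` lies on a geodesic from `a` to `b`. -/
def OnGeod {V : Type} (T : SimpleGraph V) (a s b : V) : Prop :=
  T.dist a s + T.dist s b = T.dist a b

section Geodesics

variable {V : Type} {T : SimpleGraph V}

lemma OnGeod.symm {a s b : V} (h : OnGeod T a s b) : OnGeod T b s a := by
  unfold OnGeod at *
  rw [T.dist_comm (u := b), T.dist_comm (u := s) (v := a), T.dist_comm (u := b) (v := a)]
  omega

lemma onGeod_left (a b : V) : OnGeod T a a b := by simp [OnGeod]

lemma onGeod_right (a b : V) : OnGeod T a b b := by simp [OnGeod]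

lemma OnGeod.eq_of_self (hT : T.IsTree) {a s : V} (h : OnGeod T a s a) : s = a := by
  unfold OnGeod at h
  rw [T.dist_self] at h
  exact (hT.connected.dist_eq_zero_iff.1 (by omega : T.dist a s = 0)).symm

lemma OnGeod.trans (hT : T.IsTree) {a z s b : V} (h : OnGeod T a s b) (h' : OnGeod T a z s) :
    OnGeod T a z b := by
  unfold OnGeod at *
  have h1 := hT.connected.dist_triangle (u := z) (v := s) (w := b)
  have h2 := hT.connected.dist_triangle (u := a) (v := z) (w := b)
  omega

lemma OnGeod.between (hT : T.IsTree) {a z s b : V} (h : OnGeod T a s b) (h' : OnGeod T a z s) :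
    OnGeod T z s b := by
  unfold OnGeod at *
  have h1 := hT.connected.dist_triangle (u := z) (v := s) (w := b)
  have h2 := hT.connected.dist_triangle (u := a) (v := z) (w := b)
  omega

lemma OnGeod.antisymm (hT : T.IsTree) {a x y : V} (h : OnGeod T a x y) (h' : OnGeod T a y x) :
    x = y := by
  unfold OnGeod at *
  exact hT.connected.dist_eq_zero_iff.1 (by omega)

lemma treePath_isPath (hT : T.IsTree) (a b : V) : (treePath hT a b).IsPath := by
  unfold treePath
  exact Path.isPath _

lemma eq_treePath (hT : T.IsTree) {a b : V} {p : T.Walk a b} (hp : p.IsPath) :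
    p = treePath hT a b :=
  congrArg Subtype.val ((hT.isAcyclic.subsingleton_path a b).elim
    ⟨p, hp⟩ ⟨treePath hT a b, treePath_isPath hT a b⟩)

lemma length_treePath (hT : T.IsTree) (a b : V) : (treePath hT a b).length = T.dist a b := by
  obtain ⟨p, hp⟩ := hT.connected.exists_walk_length_eq_dist a b
  rw [← eq_treePath hT (p.isPath_of_length_eq_dist hp), hp]

lemma OnGeod.treePath_eq_append (hT : T.IsTree) {a s b : V} (h : OnGeod T a s b) :
    treePath hT a b = (treePath hT a s).append (treePath hT s b) := by
  refine (eq_treePath hT (Walk.isPath_of_length_eq_dist _ ?_)).symm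
  rw [Walk.length_append, length_treePath, length_treePath]
  exact h

lemma treeDist_eq_add (hT : T.IsTree) (w : Sym2 V → ℝ) {a s b : V} (h : OnGeod T a s b) :
    treeDist hT w a b = treeDist hT w a s + treeDist hT w s b := by
  unfold treeDist
  rw [h.treePath_eq_append hT]
  simp [walkWeight, Walk.edges_append]

lemma treeDist_self (hT : T.IsTree) (w : Sym2 V → ℝ) (a : V) : treeDist hT w a a = 0 := by
  have := treeDist_eq_add hT w (onGeod_left (T := T) a a)
  linarith

lemma onGeod_of_mem_support (hT : T.IsTree) {a s b : V} (h : s ∈ (treePath hT a b).support) :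
    OnGeod T a s b := by
  classical
  have h1 := congrArg Walk.length ((treePath hT a b).take_spec h)
  rw [Walk.length_append, length_treePath] at h1
  have h2 := SimpleGraph.dist_le ((treePath hT a b).takeUntil s h)
  have h3 := SimpleGraph.dist_le ((treePath hT a b).dropUntil s h)
  have h4 := hT.connected.dist_triangle (u := a) (v := s) (w := b)
  unfold OnGeod
  omega

lemma OnGeod.mem_support (hT : T.IsTree) {a s b : V} (h : OnGeod T a s b) :
    s ∈ (treePath hT a b).support := by
  rw [h.treePath_eq_append hT, Walk.mem_support_append_iff]
  exact Or.inl (Walk.end_mem_support _)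

/-- In a tree, the geodesic `a c` is covered by the geodesics `a b` and `b c`. -/
lemma OnGeod.or (hT : T.IsTree) {a s c : V} (h : OnGeod T a s c) (b : V) :
    OnGeod T a s b ∨ OnGeod T b s c := by
  classical
  have h1 := h.mem_support hT
  rw [← eq_treePath hT ((treePath hT a b).append (treePath hT b c)).bypass_isPath] at h1
  have h2 := Walk.support_bypass_subset_support _ h1
  rw [Walk.mem_support_append_iff] at h2
  exact h2.imp (onGeod_of_mem_support hT) (onGeod_of_mem_support hT)

/-- If the geodesics `a m` and `m b` meet only in `m`, then `m` lies on the geodesic `a b`. -/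
lemma onGeod_of_forall_eq (hT : T.IsTree) {a m b : V}
    (h : ∀ z, OnGeod T a z m → OnGeod T m z b → z = m) : OnGeod T a m b := by
  have hp : ((treePath hT a m).append (treePath hT m b)).IsPath := by
    rw [Walk.isPath_def, Walk.support_append, List.nodup_append]
    have hb := (treePath_isPath hT m b).support_nodup
    refine ⟨(treePath_isPath hT a m).support_nodup, hb.tail, ?_⟩
    rintro z hz _ hz' rfl
    have := h z (onGeod_of_mem_support hT hz)
      (onGeod_of_mem_support hT (List.mem_of_mem_tail hz'))
    subst this
    rw [← Walk.cons_tail_support] at hb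
    exact (List.nodup_cons.1 hb).1 hz'
  have h1 := congrArg Walk.length (eq_treePath hT hp)
  rwa [Walk.length_append, length_treePath, length_treePath, length_treePath] at h1

/-- Any three vertices of a tree have a median. -/
lemma exists_median (hT : T.IsTree) (r a b : V) :
    ∃ m, OnGeod T r m a ∧ OnGeod T r m b ∧ OnGeod T a m b := by
  classical
  obtain ⟨m, hm, hmin⟩ := Set.exists_min_image {z | OnGeod T a z b} (fun z => T.dist r z)
    ((List.finite_toSet (treePath hT a b).support).subset fun z hz => hz.mem_support hT)
    ⟨a, onGeod_left a b⟩
  refine ⟨m, onGeod_of_forall_eq hT ?_, onGeod_of_forall_eq hT ?_, hm⟩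
  · intro z hz hz'
    have h1 := hmin z (hm.trans hT hz'.symm)
    unfold OnGeod at hz
    exact hT.connected.dist_eq_zero_iff.1 (by omega)
  · intro z hz hz'
    have h1 := hmin z (hm.symm.trans hT hz'.symm).symm
    unfold OnGeod at hz
    exact hT.connected.dist_eq_zero_iff.1 (by omega)

/-- The ancestor order of a tree rooted at `r`, with lowest common ancestors as meets. -/
@[reducible] noncomputable def rootedOrder (hT : T.IsTree) (r : V) : SemilatticeInf V where
  le x y := OnGeod T r x y
  le_refl x := onGeod_right r x
  le_trans _ _ _ h h' := h'.trans hT h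
  le_antisymm _ _ h h' := h.antisymm hT h'
  inf x y := (exists_median hT r x y).choose
  inf_le_left x y := (exists_median hT r x y).choose_spec.1
  inf_le_right x y := (exists_median hT r x y).choose_spec.2.1
  le_inf z x y hx hy := by
    obtain ⟨-, -, h⟩ := (exists_median hT r x y).choose_spec
    set m := (exists_median hT r x y).choose
    rcases hx.or hT m with h1 | h1
    · exact h1
    rcases hy.or hT m with h2 | h2
    · exact h2
    have hz : z = m := by
      have h3 := hT.connected.dist_triangle (u := x) (v := z) (w := y)
      rw [T.dist_comm (u := x) (v := z)] at h3
      unfold OnGeod at h h1 h2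
      rw [T.dist_comm (u := x) (v := m)] at h
      exact (hT.connected.dist_eq_zero_iff.1 (by omega : T.dist m z = 0)).symm
    rw [hz]
    exact onGeod_right r m

lemma rootedOrder_chain (hT : T.IsTree) (r : V) :
    letI := rootedOrder hT r
    ∀ a b c : V, a ≤ c → b ≤ c → a ≤ b ∨ b ≤ a := by
  intro a b c ha hb
  rcases OnGeod.or hT ha b with h | h
  · exact Or.inl h
  · exact Or.inr (OnGeod.between hT (OnGeod.symm hb) h.symm).symm

lemma onGeod_inf (hT : T.IsTree) (r a b : V) :
    letI := rootedOrder hT r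
    OnGeod T a (a ⊓ b) b :=
  (exists_median hT r a b).choose_spec.2.2

end Geodesics

section Order

variable {α : Type} [DecidableEq α]

/-- In a finite rooted forest, at most `|C| / t` vertices of `C` suffice to hit every rooted piece
of `C` with at least `t` vertices. -/
lemma exists_hitting_set [PartialOrder α] (hchain : ∀ a b c : α, a ≤ c → b ≤ c → a ≤ b ∨ b ≤ a)
    (t : ℕ) (C : Finset α) :
    ∃ S ⊆ C, S.card * t ≤ C.card ∧ ∀ P ⊆ C, ∀ p ∈ P, (∀ x ∈ P, p ≤ x) →
      (∀ s ∈ S, ∀ x ∈ P, p ≤ s → ¬ s ≤ x) → P.card < t := by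
  classical
  induction C using Finset.strongInduction with
  | _ C ih =>
  by_cases hC : (C.filter fun v => t ≤ (C.filter fun x => v ≤ x).card).Nonempty
  · obtain ⟨v, hv⟩ := Finset.exists_maximal hC
    have hvC := Finset.mem_filter.1 hv.prop
    obtain ⟨S, hS, hcard, hP⟩ := ih (C.filter fun x => ¬ v ≤ x) <|
      Finset.filter_ssubset.2 ⟨v, hvC.1, by simp⟩
    refine ⟨insert v S, Finset.insert_subset hvC.1 (hS.trans (Finset.filter_subset _ _)), ?_, ?_⟩
    · have h1 := Finset.card_filter_add_card_filter_not (s := C) (fun x => v ≤ x)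
      have h2 := Nat.mul_le_mul_right t (Finset.card_insert_le v S)
      rw [add_mul] at h2
      have h3 := hvC.2
      omega
    · intro P hPC p hp hmin hsep
      by_cases hvp : v ≤ p
      · have hne : ¬ p ≤ v := fun h => hsep v (Finset.mem_insert_self _ _) p hp h hvp
        by_contra! hcon
        refine hne (hv.le_of_ge ?_ hvp)
        refine Finset.mem_filter.2 ⟨hPC hp, hcon.trans (Finset.card_le_card ?_)⟩
        exact fun x hx => Finset.mem_filter.2 ⟨hPC hx, hmin x hx⟩
      · refine hP P (fun x hx => Finset.mem_filter.2 ⟨hPC hx, fun hvx => ?_⟩) p hp hmin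
          fun s hs => hsep s (Finset.mem_insert_of_mem hs)
        refine hsep v (Finset.mem_insert_self _ _) x hx ?_ hvx
        exact (hchain _ _ x hvx (hmin x hx)).resolve_left hvp
  · refine ⟨∅, Finset.empty_subset _, by simp, fun P hPC p hp hmin _ => ?_⟩
    by_contra! hcon
    refine hC ⟨p, Finset.mem_filter.2 ⟨hPC hp, hcon.trans (Finset.card_le_card ?_)⟩⟩
    exact fun x hx => Finset.mem_filter.2 ⟨hPC hx, hmin x hx⟩

/-- In a rooted tree, closing a finite set under meets at most doubles its size. -/
lemma exists_infClosed_superset [SemilatticeInf α]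
    (hchain : ∀ a b c : α, a ≤ c → b ≤ c → a ≤ b ∨ b ≤ a)
    {C : Finset α} (hC : InfClosed (C : Set α)) (S : Finset α) (hSC : S ⊆ C) :
    ∃ S', S ⊆ S' ∧ S' ⊆ C ∧ S'.card ≤ 2 * S.card ∧ InfClosed (S' : Set α) := by
  induction S using Finset.induction_on with
  | empty => exact ⟨∅, by simp, by simp, by simp, by simp [InfClosed]⟩
  | insert x S hx ih =>
  obtain ⟨S', h1, h2, h3, h4⟩ := ih ((Finset.subset_insert _ _).trans hSC)
  have hxC := hSC (Finset.mem_insert_self x S)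
  rw [Finset.card_insert_of_notMem hx]
  rcases S'.eq_empty_or_nonempty with rfl | hne
  · refine ⟨{x}, ?_, by simpa using hxC, ?_, by simp [InfClosed]⟩
    · rw [Finset.subset_empty.1 h1]
      rfl
    · rw [Finset.card_singleton]
      omega
  have hne' := hne.image (x ⊓ ·)
  obtain ⟨m, hm⟩ := Finset.exists_maximal hne'
  obtain ⟨s₀, hs₀, rfl⟩ := Finset.mem_image.1 hm.prop
  have hle : ∀ s ∈ S', x ⊓ s ≤ x ⊓ s₀ := by
    intro s hs
    rcases hchain _ _ x (inf_le_left : x ⊓ s ≤ x) (inf_le_left : x ⊓ s₀ ≤ x) with h | h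
    · exact h
    · exact hm.le_of_ge (Finset.mem_image_of_mem _ hs) h
  have hmem : ∀ s ∈ S', x ⊓ s = x ⊓ s₀ ∨ x ⊓ s ∈ S' := by
    intro s hs
    by_cases h : x ⊓ s₀ ≤ x ⊓ s
    · exact Or.inl (le_antisymm (hle s hs) h)
    right
    have h5 : x ⊓ s = s ⊓ s₀ := by
      refine le_antisymm (le_inf inf_le_right ((hle s hs).trans inf_le_right)) ?_
      rcases hchain (s ⊓ s₀) (x ⊓ s₀) s₀ inf_le_right inf_le_right with h' | h'
      · exact le_inf (h'.trans inf_le_left) inf_le_left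
      · exact absurd (le_inf inf_le_left (h'.trans inf_le_left)) h
    rw [h5]
    exact h4 hs hs₀
  have hms : ∀ s ∈ S', x ⊓ s₀ ⊓ s = x ⊓ s := by
    intro s hs
    refine le_antisymm (le_inf (inf_le_left.trans inf_le_left) inf_le_right) ?_
    exact le_inf (hle s hs) inf_le_right
  refine ⟨insert x (insert (x ⊓ s₀) S'), ?_, ?_, ?_, ?_⟩
  · exact Finset.insert_subset_insert _ (h1.trans (Finset.subset_insert _ _))
  · exact Finset.insert_subset hxC (Finset.insert_subset (hC hxC (h2 hs₀)) h2)
  · have := Finset.card_insert_le x (insert (x ⊓ s₀) S')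
    have := Finset.card_insert_le (x ⊓ s₀) S'
    omega
  · have hx' : ∀ s ∈ S', x ⊓ s ∈ insert x (insert (x ⊓ s₀) S') := by
      intro s hs
      rcases hmem s hs with h | h <;> simp [h]
    intro a ha b hb
    simp only [Finset.coe_insert, Set.mem_insert_iff, Finset.mem_coe] at ha hb
    rw [Finset.mem_coe]
    rcases ha with rfl | rfl | ha <;> rcases hb with rfl | rfl | hb
    · simp
    · simp
    · exact hx' b hb
    · simp
    · simp
    · rw [hms b hb]
      exact hx' b hb
    · exact inf_comm b a ▸ hx' a ha
    · exact inf_comm (x ⊓ s₀) a ▸ (hms a ha).symm ▸ hx' a ha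
    · exact Finset.mem_insert_of_mem (Finset.mem_insert_of_mem (h4 ha hb))

end Order

section Split

variable {V : Type} {T : SimpleGraph V}

/-- A finite vertex set closed under geodesics. -/
def GeodConvex (T : SimpleGraph V) (C : Finset V) : Prop :=
  ∀ a ∈ C, ∀ b ∈ C, ∀ z, OnGeod T a z b → z ∈ C

open Classical in
/-- The vertices of `C` that are not separated from `u` by `S`. -/
noncomputable def piece (T : SimpleGraph V) (C S : Finset V) (u : V) : Finset V :=
  C.filter fun v => ∀ s ∈ S, ¬ OnGeod T u s v

lemma mem_piece {C S : Finset V} {u v : V} :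
    v ∈ piece T C S u ↔ v ∈ C ∧ ∀ s ∈ S, ¬ OnGeod T u s v := by
  classical
  simp [piece]

lemma self_mem_piece (hT : T.IsTree) {C S : Finset V} {u : V} (hu : u ∈ C) (hS : u ∉ S) :
    u ∈ piece T C S u :=
  mem_piece.2 ⟨hu, fun _ hs h => hS (h.eq_of_self hT ▸ hs)⟩

lemma not_onGeod_of_mem_piece (hT : T.IsTree) {C S : Finset V} {u a b s : V}
    (ha : a ∈ piece T C S u) (hb : b ∈ piece T C S u) (hs : s ∈ S) : ¬ OnGeod T a s b := by
  intro h
  rcases h.or hT u with h | h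
  · exact (mem_piece.1 ha).2 s hs h.symm
  · exact (mem_piece.1 hb).2 s hs h

lemma piece_eq_of_mem (hT : T.IsTree) {C S : Finset V} {u a : V} (ha : a ∈ piece T C S u) :
    piece T C S a = piece T C S u := by
  ext v
  refine ⟨fun hv => mem_piece.2 ⟨(mem_piece.1 hv).1, fun s hs h => ?_⟩, fun hv =>
    mem_piece.2 ⟨(mem_piece.1 hv).1, fun s hs => not_onGeod_of_mem_piece hT ha hv hs⟩⟩
  rcases h.or hT a with h | h
  · exact (mem_piece.1 ha).2 s hs h
  · exact (mem_piece.1 hv).2 s hs h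

lemma geodConvex_piece (hT : T.IsTree) {C S : Finset V} (hC : GeodConvex T C) (u : V) :
    GeodConvex T (piece T C S u) := by
  intro a ha b hb z hz
  refine mem_piece.2 ⟨hC a (mem_piece.1 ha).1 b (mem_piece.1 hb).1 z hz, fun s hs h => ?_⟩
  rcases h.or hT a with h | h
  · exact (mem_piece.1 ha).2 s hs h
  · exact not_onGeod_of_mem_piece hT ha hb hs (hz.trans hT h)

open Classical in
/-- The vertices of `S` visible from `u`. -/
noncomputable def visible (T : SimpleGraph V) (S : Finset V) (u : V) : Finset V :=
  S.filter fun s => ∀ s' ∈ S, OnGeod T u s' s → s' = s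

lemma mem_visible {S : Finset V} {u s : V} :
    s ∈ visible T S u ↔ s ∈ S ∧ ∀ s' ∈ S, OnGeod T u s' s → s' = s := by
  classical
  simp [visible]

lemma visible_eq_of_mem_piece (hT : T.IsTree) {C S : Finset V} {u a : V}
    (ha : a ∈ piece T C S u) : visible T S a = visible T S u := by
  ext s
  rw [mem_visible, mem_visible]
  refine and_congr_right fun hs => forall₂_congr fun s' hs' => imp_congr_left ⟨fun h => ?_,
    fun h => ?_⟩
  · rcases h.or hT u with h | h
    · exact absurd h.symm ((mem_piece.1 ha).2 s' hs')
    · exact h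
  · rcases h.or hT a with h | h
    · exact absurd h ((mem_piece.1 ha).2 s' hs')
    · exact h

/-- Geodesics leaving a piece pass through a vertex visible from it. -/
lemma exists_mem_visible (hT : T.IsTree) {C S : Finset V} {u a v : V}
    (ha : a ∈ piece T C S u) (hv : v ∈ C) (hv' : v ∉ piece T C S u) :
    ∃ s ∈ visible T S u, OnGeod T a s v := by
  classical
  have hne : (S.filter fun s => OnGeod T a s v).Nonempty := by
    by_contra hcon
    rw [Finset.not_nonempty_iff_eq_empty, Finset.filter_eq_empty_iff] at hcon
    exact hv' (piece_eq_of_mem hT ha ▸ mem_piece.2 ⟨hv, fun s hs => hcon hs⟩)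
  obtain ⟨s, hs, hmin⟩ := Finset.exists_min_image _ (T.dist a) hne
  obtain ⟨hsS, hs⟩ := Finset.mem_filter.1 hs
  refine ⟨s, mem_visible.2 ⟨hsS, fun s' hs' h => ?_⟩, hs⟩
  rcases h.or hT a with h | h
  · exact absurd h ((mem_piece.1 ha).2 s' hs')
  · have h1 := hmin s' (Finset.mem_filter.2 ⟨hs', hs.trans hT h⟩)
    unfold OnGeod at h
    exact hT.connected.dist_eq_zero_iff.1 (by omega)

lemma eq_or_eq_of_mem_visible (hT : T.IsTree) {S : Finset V} {u x y z : V}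
    (hx : x ∈ visible T S u) (hy : y ∈ S) (hz : z ∈ visible T S u) (h : OnGeod T x y z) :
    y = x ∨ y = z := by
  rcases h.or hT u with h | h
  · exact Or.inl ((mem_visible.1 hx).2 y hy h.symm)
  · exact Or.inr ((mem_visible.1 hz).2 y hy h)

/-- At most two vertices of a meet-closed set are visible from any vertex. -/
lemma card_visible_le (hT : T.IsTree) (r : V) {S : Finset V}
    (hS : letI := rootedOrder hT r; InfClosed (S : Set V)) (u : V) :
    (visible T S u).card ≤ 2 := by
  classical
  let _ := rootedOrder hT r
  by_contra! hcard
  obtain ⟨a, b, c, ha, hb, hc, hab, hac, hbc⟩ := Finset.two_lt_card_iff.1 hcard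
  have comparable : ∀ x ∈ visible T S u, ∀ y ∈ visible T S u, x ≤ y ∨ y ≤ x := by
    intro x hx y hy
    rcases eq_or_eq_of_mem_visible hT hx (hS (mem_visible.1 hx).1 (mem_visible.1 hy).1) hy
      (onGeod_inf hT r x y) with h | h
    · exact Or.inl (inf_eq_left.1 h)
    · exact Or.inr (inf_eq_right.1 h)
  have chain : ∀ x ∈ visible T S u, ∀ y ∈ visible T S u, ∀ z ∈ visible T S u, x ≤ y → y ≤ z →
      y = x ∨ y = z := fun x hx y hy z hz hxy hyz =>
    eq_or_eq_of_mem_visible hT hx (mem_visible.1 hy).1 hz (OnGeod.between hT hyz hxy)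
  rcases comparable a ha b hb with h1 | h1 <;> rcases comparable b hb c hc with h2 | h2 <;>
    rcases comparable a ha c hc with h3 | h3
  · rcases chain a ha b hb c hc h1 h2 with h | h <;> simp_all
  · rcases chain a ha b hb c hc h1 h2 with h | h <;> simp_all
  · rcases chain a ha c hc b hb h3 h2 with h | h <;> simp_all
  · rcases chain c hc a ha b hb h3 h1 with h | h <;> simp_all
  · rcases chain b hb a ha c hc h1 h3 with h | h <;> simp_all
  · rcases chain b hb c hc a ha h2 h3 with h | h <;> simp_all
  · rcases chain c hc b hb a ha h2 h1 with h | h <;> simp_all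
  · rcases chain c hc b hb a ha h2 h1 with h | h <;> simp_all

/-- A convex set splits along few vertices into small pieces with at most two boundary vertices. -/
lemma exists_splitting (hT : T.IsTree) {C : Finset V} (hC : GeodConvex T C) {t : ℕ} :
    ∃ S ⊆ C, S.card * t ≤ 2 * C.card ∧ (∀ u, (visible T S u).card ≤ 2) ∧
      ∀ u ∈ C, u ∉ S → (piece T C S u).card < t := by
  classical
  rcases C.eq_empty_or_nonempty with rfl | ⟨r, -⟩
  · exact ⟨∅, by simp, by simp, by simp [visible], by simp⟩
  let _ := rootedOrder hT r
  have hchain : ∀ a b c : V, a ≤ c → b ≤ c → a ≤ b ∨ b ≤ a := rootedOrder_chain hT r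
  have hinf : ∀ {D : Finset V}, GeodConvex T D → InfClosed (D : Set V) :=
    fun hD a ha b hb => hD a ha b hb _ (onGeod_inf hT r a b)
  obtain ⟨S₀, hS₀, hcard₀, hsmall⟩ := exists_hitting_set hchain t C
  obtain ⟨S, h1, h2, h3, h4⟩ := exists_infClosed_superset hchain (hinf hC) S₀ hS₀
  refine ⟨S, h2, ?_, card_visible_le hT r h4, fun u hu huS => ?_⟩
  · calc S.card * t ≤ 2 * S₀.card * t := Nat.mul_le_mul_right t h3
      _ = 2 * (S₀.card * t) := by ring
      _ ≤ 2 * C.card := by omega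
  · have hu' := self_mem_piece hT hu huS
    obtain ⟨p, hp⟩ := Finset.exists_minimal ⟨u, hu'⟩
    refine hsmall _ (fun x hx => (mem_piece.1 hx).1) p hp.prop (fun x hx => ?_) ?_
    · have := hinf (geodConvex_piece hT hC u) hp.prop hx
      exact (hp.le_of_le this inf_le_left).trans inf_le_right
    · intro s hs x hx hps hsx
      exact not_onGeod_of_mem_piece hT hp.prop hx (h1 hs) (OnGeod.between hT hsx hps)

end Split

section Bags

variable {V : Type} [DecidableEq V] {w : ℕ}

/-- `BagTree w U 𝓑` says that the bags `𝓑`, covering the vertices `U`, arise from an empty bag by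
repeatedly attaching a bag made of a new vertex and at most `w` vertices of an earlier bag. -/
inductive BagTree (w : ℕ) : Finset V → Set (Finset V) → Prop
  | empty : BagTree w ∅ {∅}
  | attach {U : Finset V} {𝓑 : Set (Finset V)} {B Y : Finset V} {v : V} : BagTree w U 𝓑 → B ∈ 𝓑 →
      Y ⊆ B → Y.card ≤ w → v ∉ U → BagTree w (insert v U) (insert (insert v Y) 𝓑)

/-- Two vertices share a bag of `𝓑`. -/
def Linked (𝓑 : Set (Finset V)) (u v : V) : Prop := ∃ B ∈ 𝓑, u ∈ B ∧ v ∈ B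

omit [DecidableEq V] in
lemma Linked.symm {𝓑 : Set (Finset V)} {u v : V} (h : Linked 𝓑 u v) : Linked 𝓑 v u := by
  obtain ⟨B, hB, hu, hv⟩ := h
  exact ⟨B, hB, hv, hu⟩

omit [DecidableEq V] in
lemma Linked.mono {𝓑 𝓑' : Set (Finset V)} (hsub : 𝓑 ⊆ 𝓑') {u v : V} (h : Linked 𝓑 u v) :
    Linked 𝓑' u v := by
  obtain ⟨B, hB, hu, hv⟩ := h
  exact ⟨B, hsub hB, hu, hv⟩

lemma BagTree.attach_finset {U : Finset V} {𝓑 : Set (Finset V)} (h : BagTree w U 𝓑)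
    {B X : Finset V} (hB : B ∈ 𝓑) (hX : X ⊆ B) (S : Finset V) (hSU : Disjoint S U)
    (hcard : X.card + S.card ≤ w) :
    ∃ 𝓑', 𝓑 ⊆ 𝓑' ∧ BagTree w (U ∪ S) 𝓑' ∧ ∃ B' ∈ 𝓑', X ∪ S ⊆ B' := by
  induction S using Finset.induction_on with
  | empty => exact ⟨𝓑, subset_rfl, by simpa using h, B, hB, by simpa using hX⟩
  | insert v S hv ih =>
  rw [Finset.card_insert_of_notMem hv] at hcard
  obtain ⟨hvU, hSU⟩ := Finset.disjoint_insert_left.1 hSU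
  obtain ⟨𝓑', h1, h2, B', hB', hsub⟩ := ih hSU (by omega)
  refine ⟨insert (insert v (X ∪ S)) 𝓑', h1.trans (Set.subset_insert _ _), ?_, _,
    Set.mem_insert _ _, ?_⟩
  · rw [Finset.union_insert]
    refine h2.attach hB' hsub ?_ (by simp [hv, hvU])
    have := Finset.card_union_le X S
    omega
  · rw [Finset.union_insert]

variable {T : SimpleGraph V}

/-- `u` and `v` are joined by a geodesic with at most three linked hops. -/
def ThreeHop (T : SimpleGraph V) (𝓑 : Set (Finset V)) (u v : V) : Prop :=
  ∃ a b, Linked 𝓑 u a ∧ Linked 𝓑 a b ∧ Linked 𝓑 b v ∧ OnGeod T u a v ∧ OnGeod T a b v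

omit [DecidableEq V] in
lemma ThreeHop.mono {𝓑 𝓑' : Set (Finset V)} (hsub : 𝓑 ⊆ 𝓑') {u v : V} (h : ThreeHop T 𝓑 u v) :
    ThreeHop T 𝓑' u v := by
  obtain ⟨a, b, h1, h2, h3, h4, h5⟩ := h
  exact ⟨a, b, h1.mono hsub, h2.mono hsub, h3.mono hsub, h4, h5⟩

/-- Every convex set with fewer than `K ^ j` vertices can be attached to a bag tree so that all of
its vertices share bags with `X`, and all of its pairs are joined by three hops. -/
lemma exists_bagTree (hT : T.IsTree) {K : ℕ} (hK : 0 < K) (j : ℕ) :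
    ∀ {C U : Finset V} {𝓑 : Set (Finset V)} {B X : Finset V}, GeodConvex T C → C.card < K ^ j →
      BagTree w U 𝓑 → Disjoint C U → B ∈ 𝓑 → X ⊆ B → X.card + 2 * j + 2 * K ≤ w →
      ∃ 𝓑', 𝓑 ⊆ 𝓑' ∧ BagTree w (U ∪ C) 𝓑' ∧ (∀ c ∈ C, ∃ B' ∈ 𝓑', c ∈ B' ∧ X ⊆ B') ∧
        ∀ u ∈ C, ∀ v ∈ C, ThreeHop T 𝓑' u v := by
  induction j with
  | zero =>
    intro C U 𝓑 B X _ hcard h𝓑 _ _ _ _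
    obtain rfl : C = ∅ := by simpa using hcard
    exact ⟨𝓑, subset_rfl, by simpa using h𝓑, by simp, by simp⟩
  | succ j ih =>
  intro C U 𝓑 B X hC hcard h𝓑 hCU hB hX hw
  obtain ⟨S, hSC, hScard, hvis, hsmall⟩ := exists_splitting hT hC (t := K ^ j)
  have hS2K : S.card ≤ 2 * K := by
    have hpos : 0 < K ^ j := Nat.pow_pos hK
    refine Nat.le_of_mul_le_mul_right (hScard.trans ?_) hpos
    calc 2 * C.card ≤ 2 * K ^ (j + 1) := by omega
      _ = 2 * K * K ^ j := by ring
  obtain ⟨𝓑₁, h𝓑₁, hS, B₁, hB₁, hXS⟩ := h𝓑.attach_finset hB hX S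
    (Finset.disjoint_of_subset_left hSC hCU) (by omega)
  have pieces : ∀ D ⊆ C \ S, ∃ (W : Finset V) (𝓑' : Set (Finset V)), 𝓑₁ ⊆ 𝓑' ∧ D ⊆ W ∧
      W ⊆ C \ S ∧ (∀ u ∈ W, piece T C S u ⊆ W) ∧ BagTree w (U ∪ S ∪ W) 𝓑' ∧
      ∀ u ∈ W, (∃ B' ∈ 𝓑', u ∈ B' ∧ X ∪ visible T S u ⊆ B') ∧
        ∀ v ∈ piece T C S u, ThreeHop T 𝓑' u v := by
    intro D
    induction D using Finset.induction_on with
    | empty => exact fun _ => ⟨∅, 𝓑₁, by simpa using hS⟩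
    | insert a D _ ihD =>
    intro hD
    obtain ⟨W, 𝓑', h1, h2, h3, h4, h5, h6⟩ := ihD ((Finset.subset_insert _ _).trans hD)
    by_cases haW : a ∈ W
    · exact ⟨W, 𝓑', h1, Finset.insert_subset haW h2, h3, h4, h5, h6⟩
    obtain ⟨haC, haS⟩ := Finset.mem_sdiff.1 (hD (Finset.mem_insert_self a D))
    have haP := self_mem_piece hT haC haS
    have hPS : ∀ x ∈ piece T C S a, x ∉ S := fun x hx hxS =>
      (mem_piece.1 hx).2 x hxS (onGeod_right a x)
    have hPW : ∀ x ∈ piece T C S a, x ∉ W := fun x hx hxW =>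
      haW (h4 x hxW (piece_eq_of_mem hT hx ▸ haP))
    have hdisj : Disjoint (piece T C S a) (U ∪ S ∪ W) := by
      refine Finset.disjoint_left.2 fun x hx hx' => ?_
      rcases Finset.mem_union.1 hx' with hx' | hx'
      · rcases Finset.mem_union.1 hx' with hx' | hx'
        · exact Finset.disjoint_left.1 hCU (mem_piece.1 hx).1 hx'
        · exact hPS x hx hx'
      · exact hPW x hx hx'
    have hXa : X ∪ visible T S a ⊆ B₁ := (Finset.union_subset_union_right
      fun s hs => (mem_visible.1 hs).1).trans hXS
    have hXcard : (X ∪ visible T S a).card + 2 * j + 2 * K ≤ w := by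
      have := Finset.card_union_le X (visible T S a)
      have := hvis a
      omega
    obtain ⟨𝓑₂, g1, g2, g3, g4⟩ := ih (geodConvex_piece hT hC a) (hsmall a haC haS) h5 hdisj
      (h1 hB₁) hXa hXcard
    refine ⟨W ∪ piece T C S a, 𝓑₂, h1.trans g1, ?_, ?_, ?_, ?_, ?_⟩
    · exact Finset.insert_subset (Finset.mem_union_right _ haP)
        (h2.trans Finset.subset_union_left)
    · exact Finset.union_subset h3 fun x hx =>
        Finset.mem_sdiff.2 ⟨(mem_piece.1 hx).1, hPS x hx⟩
    · intro u hu
      rcases Finset.mem_union.1 hu with hu | hu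
      · exact (h4 u hu).trans Finset.subset_union_left
      · exact piece_eq_of_mem hT hu ▸ Finset.subset_union_right
    · rwa [← Finset.union_assoc]
    · intro u hu
      rcases Finset.mem_union.1 hu with hu | hu
      · obtain ⟨⟨B', hB', huB', hsub⟩, hhop⟩ := h6 u hu
        exact ⟨⟨B', g1 hB', huB', hsub⟩, fun v hv => (hhop v hv).mono g1⟩
      · rw [piece_eq_of_mem hT hu, visible_eq_of_mem_piece hT hu]
        exact ⟨g3 u hu, g4 u hu⟩
  obtain ⟨W, 𝓑', h1, h2, h3, -, h5, h6⟩ := pieces (C \ S) subset_rfl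
  obtain rfl : W = C \ S := h3.antisymm h2
  rw [Finset.union_assoc, Finset.union_sdiff_of_subset hSC] at h5
  have portal : ∀ u ∈ C, ∀ v ∈ C, (u ∉ S → v ∉ piece T C S u) →
      ∃ s ∈ S, Linked 𝓑' u s ∧ OnGeod T u s v := by
    intro u hu v hv huv
    by_cases huS : u ∈ S
    · have := hXS (Finset.mem_union_right _ huS)
      exact ⟨u, huS, ⟨B₁, h1 hB₁, this, this⟩, onGeod_left u v⟩
    · obtain ⟨s, hs, hgeod⟩ := exists_mem_visible hT (self_mem_piece hT hu huS) hv (huv huS)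
      obtain ⟨B', hB', huB', hsub⟩ := (h6 u (Finset.mem_sdiff.2 ⟨hu, huS⟩)).1
      exact ⟨s, (mem_visible.1 hs).1, ⟨B', hB', huB', hsub (Finset.mem_union_right _ hs)⟩, hgeod⟩
  refine ⟨𝓑', h𝓑₁.trans h1, h5, fun c hc => ?_, fun u hu v hv => ?_⟩
  · by_cases hcS : c ∈ S
    · exact ⟨B₁, h1 hB₁, hXS (Finset.mem_union_right _ hcS),
        Finset.subset_union_left.trans hXS⟩
    · obtain ⟨B', hB', hcB', hsub⟩ := (h6 c (Finset.mem_sdiff.2 ⟨hc, hcS⟩)).1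
      exact ⟨B', hB', hcB', Finset.subset_union_left.trans hsub⟩
  · by_cases huv : u ∉ S ∧ v ∈ piece T C S u
    · exact (h6 u (Finset.mem_sdiff.2 ⟨hu, huv.1⟩)).2 v huv.2
    obtain ⟨a, haS, hua, ha⟩ := portal u hu v hv fun h h' => huv ⟨h, h'⟩
    obtain ⟨b, hbS, hvb, hb⟩ := portal v hv a (hSC haS) fun _ h =>
      (mem_piece.1 h).2 a haS (onGeod_right v a)
    exact ⟨a, b, hua, ⟨B₁, h1 hB₁, hXS (Finset.mem_union_right _ haS),
      hXS (Finset.mem_union_right _ hbS)⟩, hvb.symm, ha, hb.symm⟩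

end Bags

section Decomposition

/-- The graph joining every non-root index to its parent. -/
def parentGraph {ι : Type} (root : ι) (p : ι → ι) : SimpleGraph ι :=
  SimpleGraph.fromRel fun i j => i ≠ root ∧ p i = j

lemma parentGraph_adj {ι : Type} {root : ι} {p : ι → ι} {i : ι} (hi : i ≠ root) (hne : i ≠ p i) :
    (parentGraph root p).Adj i (p i) := by
  simp [parentGraph, hi, hne]

lemma parentGraph_isTree {ι : Type} [Finite ι] {root : ι} {p : ι → ι} {depth : ι → ℕ}
    (hp : ∀ i, i ≠ root → depth (p i) < depth i) : (parentGraph root p).IsTree := by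
  classical
  have := Fintype.ofFinite ι
  have hreach : ∀ n i, depth i = n → (parentGraph root p).Reachable i root := by
    intro n
    induction n using Nat.strong_induction_on with
    | _ n ih =>
    intro i hi
    by_cases hroot : i = root
    · rw [hroot]
    · have hlt := hp i hroot
      have hne : i ≠ p i := fun h => by
        rw [← h] at hlt
        exact lt_irrefl _ hlt
      exact (parentGraph_adj hroot hne).reachable.trans (ih _ (hi ▸ hlt) _ rfl)
  have hconn : (parentGraph root p).Connected :=
    { preconnected := fun i j => (hreach _ i rfl).trans (hreach _ j rfl).symm
      nonempty := ⟨root⟩ }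
  refine isTree_iff_connected_and_card.2 ⟨hconn, le_antisymm ?_
    hconn.card_vert_le_card_edgeSet_add_one⟩
  have hsub : (parentGraph root p).edgeSet ⊆
      ((Finset.univ.erase root).image fun i => s(i, p i) : Finset (Sym2 ι)) := by
    intro e he
    induction e using Sym2.ind with
    | _ i j =>
    rw [SimpleGraph.mem_edgeSet, parentGraph, SimpleGraph.fromRel_adj] at he
    rw [Finset.mem_coe, Finset.mem_image]
    rcases he.2 with ⟨h1, h2⟩ | ⟨h1, h2⟩
    · exact ⟨i, by simp [h1], by rw [h2]⟩
    · exact ⟨j, by simp [h1], by rw [h2, Sym2.eq_swap]⟩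
  have h1 := Nat.card_mono (Finset.finite_toSet _) hsub
  rw [Nat.card_coe_set_eq, Nat.card_coe_set_eq, Set.ncard_coe_finset] at h1
  have h2 := (Finset.card_image_le (s := Finset.univ.erase root)
    (f := fun i => s(i, p i)))
  have h3 := Finset.card_erase_add_one (Finset.mem_univ root)
  rw [Finset.card_univ, ← Nat.card_eq_fintype_card] at h3
  rw [Nat.card_coe_set_eq]
  omega

variable {V : Type} [DecidableEq V] {w : ℕ}

lemma BagTree.exists_parent {U : Finset V} {𝓑 : Set (Finset V)} (h : BagTree w U 𝓑) :
    ∃ (bag : Option V → Finset V) (p : Option V → Option V) (depth : Option V → ℕ),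
      bag none = ∅ ∧ (∀ i, (bag i).card ≤ w + 1) ∧ (∀ v ∈ U, v ∈ bag (some v)) ∧
      (∀ v ∉ U, bag (some v) = ∅) ∧
      (∀ v, ∀ u ∈ bag (some v), u = v ∨ u ∈ bag (p (some v))) ∧
      (∀ v, depth (p (some v)) < depth (some v)) ∧
      (∀ u v, p (some u) = some v → v ∈ U) ∧ ∀ B ∈ 𝓑, ∃ i, bag i = B := by
  induction h with
  | empty =>
    exact ⟨fun _ => ∅, fun _ => none, fun i => i.elim 0 fun _ => 1, by simp, by simp, by simp,
      by simp, by simp, by simp, by simp, by simp⟩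
  | @attach U 𝓑 B Y v h hB hY hcard hv ih =>
  obtain ⟨bag, p, depth, h1, h2, h3, h4, h5, h6, h7, h8⟩ := ih
  have h9 : ∀ B ∈ 𝓑, ∃ i, (∀ u, i = some u → u ∈ U) ∧ bag i = B := by
    intro B hB
    obtain ⟨_ | u, rfl⟩ := h8 B hB
    · exact ⟨none, by simp, rfl⟩
    by_cases hu : u ∈ U
    · exact ⟨some u, fun _ h => Option.some.inj h ▸ hu, rfl⟩
    · exact ⟨none, by simp, by rw [h1, h4 u hu]⟩
  obtain ⟨i, hi, rfl⟩ := h9 B hB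
  have hne : ∀ u ∈ U, (some u : Option V) ≠ some v := fun u hu huv =>
    hv (Option.some.inj huv ▸ hu)
  have hiv : i ≠ some v := fun hiv => hv (hi v hiv)
  have hpv : ∀ u, p (some u) ≠ some v := fun u hu => hv (h7 u v hu)
  refine ⟨Function.update bag (some v) (insert v Y), Function.update p (some v) i,
    Function.update depth (some v) (depth i + 1), ?_, ?_, ?_, ?_, ?_, ?_, ?_, ?_⟩
  · rw [Function.update_of_ne (by simp), h1]
  · intro k
    by_cases hk : k = some v
    · rw [hk, Function.update_self]
      exact (Finset.card_insert_le _ _).trans (by omega)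
    · rw [Function.update_of_ne hk]
      exact h2 k
  · intro u hu
    rcases Finset.mem_insert.1 hu with rfl | hu
    · simp
    · rw [Function.update_of_ne (hne u hu)]
      exact h3 u hu
  · intro u hu
    rw [Finset.mem_insert, not_or] at hu
    rw [Function.update_of_ne (by simpa using hu.1)]
    exact h4 u hu.2
  · intro u x hx
    by_cases huv : u = v
    · subst huv
      rw [Function.update_self] at hx ⊢
      rw [Function.update_of_ne hiv]
      exact (Finset.mem_insert.1 hx).imp id fun h => hY h
    · have huv' : (some u : Option V) ≠ some v := by simpa using huv
      rw [Function.update_of_ne huv'] at hx ⊢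
      rw [Function.update_of_ne (hpv u)]
      exact h5 u x hx
  · intro u
    by_cases huv : u = v
    · subst huv
      rw [Function.update_self, Function.update_self, Function.update_of_ne hiv]
      omega
    · have huv' : (some u : Option V) ≠ some v := by simpa using huv
      rw [Function.update_of_ne huv', Function.update_of_ne huv', Function.update_of_ne (hpv u)]
      exact h6 u
  · intro u x hx
    by_cases huv : u = v
    · subst huv
      rw [Function.update_self] at hx
      exact Finset.mem_insert_of_mem (hi x hx)
    · rw [Function.update_of_ne (by simpa using huv)] at hx
      exact Finset.mem_insert_of_mem (h7 u x hx)
  · rintro B (rfl | hB)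
    · exact ⟨some v, Function.update_self _ _ _⟩
    · obtain ⟨k, hk, rfl⟩ := h9 B hB
      exact ⟨k, Function.update_of_ne (fun h => hv (hk v h)) _ _⟩

lemma BagTree.treewidthLE [Fintype V] {𝓑 : Set (Finset V)} (h : BagTree w Finset.univ 𝓑) :
    TreewidthLE (SimpleGraph.fromRel (Linked 𝓑)) w := by
  obtain ⟨bag, p, depth, h1, h2, h3, -, h5, h6, -, h8⟩ := h.exists_parent
  have hdepth : ∀ i, i ≠ none → depth (p i) < depth i := by
    rintro (_ | v) hi
    · exact absurd rfl hi
    · exact h6 v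
  refine ⟨Option V, ⟨parentGraph none p, parentGraph_isTree hdepth, bag,
    fun v => ⟨some v, h3 v (Finset.mem_univ v)⟩, fun u v huv => ?_, fun v => ?_⟩, fun i => ?_⟩
  · obtain ⟨B, hB, hu, hv⟩ : Linked 𝓑 u v := huv.2.elim id Linked.symm
    obtain ⟨i, rfl⟩ := h8 B hB
    exact ⟨i, hu, hv⟩
  · have hmem : some v ∈ {i | v ∈ bag i} := h3 v (Finset.mem_univ v)
    have hreach : ∀ n i, depth i = n → ∀ hi : i ∈ {i | v ∈ bag i},
        ((parentGraph none p).induce {i | v ∈ bag i}).Reachable ⟨i, hi⟩ ⟨some v, hmem⟩ := by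
      intro n
      induction n using Nat.strong_induction_on with
      | _ n ih =>
      rintro (_ | u) hn hi
      · simp [h1] at hi
      rcases h5 u v hi with rfl | hv
      · rfl
      · have hlt := h6 u
        have hne : some u ≠ p (some u) := fun h => by
          rw [← h] at hlt
          exact lt_irrefl _ hlt
        have hadj : ((parentGraph none p).induce {i | v ∈ bag i}).Adj ⟨some u, hi⟩
            ⟨p (some u), hv⟩ := parentGraph_adj (by simp) hne
        exact hadj.reachable.trans (ih _ (hn ▸ hlt) _ rfl hv)
    exact { preconnected := fun i j => (hreach _ i.1 rfl i.2).trans (hreach _ j.1 rfl j.2).symm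
            nonempty := ⟨⟨some v, hmem⟩⟩ }
  · have : ((bag i).card : ℝ) ≤ w + 1 := by exact_mod_cast h2 i
    show ((bag i).card : ℝ) - 1 ≤ w
    linarith

end Decomposition

section Hops

variable {V : Type}

/-- `H` has a path with `m` edges from `u` to `v` of total `d`-length `ℓ`. -/
def HopPath (H : SimpleGraph V) (d : V → V → ℝ) (m : ℕ) (u v : V) (ℓ : ℝ) : Prop :=
  ∃ x : Fin (m + 1) → V, x 0 = u ∧ x (Fin.last m) = v ∧
    (∀ i : Fin m, H.Adj (x i.castSucc) (x i.succ)) ∧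
    (∑ i : Fin m, d (x i.castSucc) (x i.succ)) = ℓ

lemma hopPath_zero (H : SimpleGraph V) (d : V → V → ℝ) (u : V) : HopPath H d 0 u u 0 :=
  ⟨fun _ => u, rfl, rfl, fun i => i.elim0, by simp⟩

lemma HopPath.cons {H : SimpleGraph V} {d : V → V → ℝ} {m : ℕ} {u v s : V} {ℓ : ℝ}
    (hadj : H.Adj u s) (h : HopPath H d m s v ℓ) : HopPath H d (m + 1) u v (d u s + ℓ) := by
  obtain ⟨x, rfl, rfl, h3, rfl⟩ := h
  refine ⟨Fin.cons u x, rfl, ?_, fun i => ?_, ?_⟩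
  · rw [← Fin.succ_last, Fin.cons_succ]
  · induction i using Fin.cases with
    | zero => simpa using hadj
    | succ i =>
      rw [← Fin.succ_castSucc, Fin.cons_succ, Fin.cons_succ]
      exact h3 i
  · rw [Fin.sum_univ_succ]
    simp

lemma HopPath.cons_linked {𝓑 : Set (Finset V)} {d : V → V → ℝ} (hd : ∀ a, d a a = 0) {k : ℕ}
    {u v s : V} {ℓ : ℝ} (hus : Linked 𝓑 u s)
    (h : ∃ m ≤ k, HopPath (SimpleGraph.fromRel (Linked 𝓑)) d m s v ℓ) :
    ∃ m ≤ k + 1, HopPath (SimpleGraph.fromRel (Linked 𝓑)) d m u v (d u s + ℓ) := by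
  obtain ⟨m, hm, h⟩ := h
  by_cases hne : u = s
  · subst hne
    exact ⟨m, by omega, by rwa [hd, zero_add]⟩
  · exact ⟨m + 1, by omega, h.cons ⟨hne, Or.inl hus⟩⟩

lemma ThreeHop.isOneSpannerHop {T : SimpleGraph V} (hT : T.IsTree) (w : Sym2 V → ℝ)
    {𝓑 : Set (Finset V)} (h : ∀ u v, ThreeHop T 𝓑 u v) :
    IsOneSpannerHop (SimpleGraph.fromRel (Linked 𝓑)) (treeDist hT w) 3 := by
  intro u v
  obtain ⟨a, b, h1, h2, h3, h4, h5⟩ := h u v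
  have hd := treeDist_self hT w
  obtain ⟨m, hm, x, hx0, hxm, hadj, hsum⟩ := HopPath.cons_linked hd h1 <|
    HopPath.cons_linked hd h2 <| HopPath.cons_linked hd h3
      ⟨0, le_rfl, hopPath_zero (SimpleGraph.fromRel (Linked 𝓑)) (treeDist hT w) v⟩
  refine ⟨m, x, hm, hx0, hxm, hadj, hsum.trans ?_⟩
  rw [add_zero, treeDist_eq_add hT w h4, treeDist_eq_add hT w h5]

end Hops

section Numerics

lemma logb_two_le_self {x : ℝ} (hx : 0 < x) : Real.logb 2 x ≤ x := by
  have h2 := Real.log_two_gt_d9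
  have h2' := Real.log_two_lt_d9
  rw [Real.logb, div_le_iff₀ (by linarith)]
  have h1 := Real.log_le_sub_one_of_pos (show 0 < x / 2 by linarith)
  rw [Real.log_div hx.ne' (by norm_num)] at h1
  nlinarith

/-- A branching factor and a recursion depth balancing the width. -/
lemma exists_branching {n : ℕ} (hn : 4 ≤ n) : ∃ K j : ℕ, 0 < K ∧ n < K ^ j ∧
    ((2 * j + 2 * K : ℕ) : ℝ) ≤ 12 * Real.logb 2 n / Real.logb 2 (Real.logb 2 n) := by
  have hn' : (4 : ℝ) ≤ n := by exact_mod_cast hn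
  set L := Real.logb 2 n with hL
  have hL2 : 2 ≤ L := by
    rw [hL, Real.le_logb_iff_rpow_le (by norm_num) (by linarith)]
    norm_num
    exact_mod_cast hn
  set ℓ := Real.logb 2 L with hℓ
  have hℓ1 : 1 ≤ ℓ := by
    rw [hℓ, Real.le_logb_iff_rpow_le (by norm_num) (by linarith)]
    simpa using hL2
  have hsqrt : 0 < √L := Real.sqrt_pos.2 (by linarith)
  have hsq : √L * √L = L := Real.mul_self_sqrt (by linarith)
  have hlogsqrt : Real.logb 2 √L = ℓ / 2 := by
    have : ℓ = Real.logb 2 √L + Real.logb 2 √L := by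
      rw [← Real.logb_mul hsqrt.ne' hsqrt.ne', hsq]
    linarith
  refine ⟨⌈√L⌉₊, ⌊2 * L / ℓ⌋₊ + 1, Nat.ceil_pos.2 hsqrt, ?_, ?_⟩
  · have hK : √L ≤ ⌈√L⌉₊ := Nat.le_ceil _
    have hKpos : (0 : ℝ) < ⌈√L⌉₊ := hsqrt.trans_le hK
    have hlogK : ℓ / 2 ≤ Real.logb 2 ⌈√L⌉₊ :=
      hlogsqrt ▸ Real.logb_le_logb_of_le (by norm_num) hsqrt hK
    have hj := Nat.lt_floor_add_one (2 * L / ℓ)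
    rw [div_lt_iff₀ (by linarith)] at hj
    have : Real.logb 2 n < Real.logb 2 ((⌈√L⌉₊ : ℝ) ^ (⌊2 * L / ℓ⌋₊ + 1)) := by
      rw [Real.logb_pow]
      push_cast
      have := mul_le_mul_of_nonneg_left hlogK
        (by positivity : (0 : ℝ) ≤ (⌊2 * L / ℓ⌋₊ : ℝ) + 1)
      linarith
    exact_mod_cast (Real.logb_lt_logb_iff (by norm_num) (by linarith) (by positivity)).1 this
  · have hj := Nat.floor_le (show 0 ≤ 2 * L / ℓ by positivity)
    have hK := (Nat.ceil_lt_add_one hsqrt.le).le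
    have h1 : 1 ≤ L / ℓ := (one_le_div (by linarith)).2 (logb_two_le_self (by linarith))
    have h2 : √L ≤ 2 * (L / ℓ) := by
      rw [← mul_div_assoc, le_div_iff₀ (by linarith)]
      have := logb_two_le_self hsqrt
      nlinarith
    rw [mul_div_assoc] at hj
    rw [mul_div_assoc, mul_div_assoc]
    push_cast
    linarith

end Numerics

end TreeShortcut

/-- There is an absolute constant `c > 0` such that for every `n ≥ 4`,
every edge-weighted tree on `n` vertices admits a shortcutting with hop-diameter `3` and
treewidth at most `c·log n / log log n`. -/
theorem stmt2 :
    ∃ c : ℝ, 0 < c ∧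
      ∀ n : ℕ, 4 ≤ n →
        ∀ (V : Type) (_ : Fintype V), Fintype.card V = n →
          ∀ (T : SimpleGraph V) (hT : T.IsTree) (w : Sym2 V → ℝ),
            (∀ e ∈ T.edgeSet, 0 < w e) →
            ∃ G' : SimpleGraph V,
              IsOneSpannerHop G' (treeDist hT w) 3 ∧
              TreewidthLE G' (c * Real.logb 2 n / Real.logb 2 (Real.logb 2 n)) := by
  classical
  refine ⟨12, by norm_num, fun n hn V _ hV T hT w _ => ?_⟩
  obtain ⟨K, j, hK, hlt, hle⟩ := TreeShortcut.exists_branching hn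
  obtain ⟨𝓑, -, h𝓑, -, hhop⟩ := TreeShortcut.exists_bagTree (w := 2 * j + 2 * K) hT hK j
    (C := Finset.univ) (U := ∅) (X := ∅) (fun _ _ _ _ _ _ => Finset.mem_univ _)
    (by rwa [Finset.card_univ, hV]) .empty (by simp) rfl (by simp) (by simp)
  rw [Finset.empty_union] at h𝓑
  refine ⟨SimpleGraph.fromRel (TreeShortcut.Linked 𝓑), TreeShortcut.ThreeHop.isOneSpannerHop hT w
    fun u v => hhop u (Finset.mem_univ u) v (Finset.mem_univ v), ?_⟩
  obtain ⟨ι, td, htd⟩ := h𝓑.treewidthLE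
  exact ⟨ι, td, fun i => (htd i).trans hle⟩
end
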